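/- arXiv:2105.05452 — 4 statements merged into one kernel-verified Lean document; each statement's English description precedes it below -/
import Mathlib

section
/- Let g be a polynomial of degree n ≥ 2. Then the antiholomorphic flow ż = conj(g(z)) has uncountably many pairwise disjoint trajectories tending to infinity in finite increasing time: for each S ∈ ℝ and all sufficiently large R > 0, each pre-image under v = G(z), where G' = g, of the half-line {r + iS : r ≥ R} is traversed by such a trajectory. -/
open Filter Set

noncomputable section

/-- `z` solves `ż = f(z)` on the interval `(a, b) ⊆ ℝ` (endpoints in `EReal`). -/
def FlowSol (f : ℂ → ℂ) (a b : EReal) (z : ℝ → ℂ) : Prop :=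
  a < b ∧ ∀ t : ℝ, a < (t : EReal) → (t : EReal) < b → HasDerivAt z (f (z t)) t

/-- `z` is a maximal solution of `ż = f(z)` on `(a, b)`. -/
def MaxFlowSol (f : ℂ → ℂ) (a b : EReal) (z : ℝ → ℂ) : Prop :=
  FlowSol f a b z ∧
  ∀ a' b' : EReal, ∀ w : ℝ → ℂ, FlowSol f a' b' w → a' ≤ a → b ≤ b' →
    (∀ t : ℝ, a < (t : EReal) → (t : EReal) < b → w t = z t) → a' = a ∧ b' = b

/-- The image (as a curve in `ℂ`) of the solution `z` on `(a, b)`. -/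
def Traj (a b : EReal) (z : ℝ → ℂ) : Set ℂ :=
  z '' {t : ℝ | a < (t : EReal) ∧ (t : EReal) < b}

/-- The maximal trajectory `z` on `(a,b)` tends to infinity in finite increasing time. -/
def EscapesInFiniteTime (f : ℂ → ℂ) (a b : EReal) (z : ℝ → ℂ) : Prop :=
  MaxFlowSol f a b z ∧ ∃ c : ℝ, b = (c : EReal) ∧
    Tendsto z (nhdsWithin c (Set.Iio c)) (Bornology.cobounded ℂ)

def TranscendentalEntire (f : ℂ → ℂ) : Prop :=
  Differentiable ℂ f ∧ ¬ ∃ p : Polynomial ℂ, ∀ z : ℂ, f z = p.eval z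

section MaximalSolutions

open scoped Topology

/-- The real times lying in the open interval `(a, b)` with endpoints in `EReal`. -/
def flowTimes (a b : EReal) : Set ℝ := {t : ℝ | a < (t : EReal) ∧ (t : EReal) < b}

lemma isOpen_flowTimes (a b : EReal) : IsOpen (flowTimes a b) :=
  (isOpen_Ioo (a := a) (b := b)).preimage continuous_coe_real_ereal

lemma ordConnected_flowTimes (a b : EReal) : (flowTimes a b).OrdConnected :=
  ⟨fun _ hx _ hy _ hz => ⟨hx.1.trans_le (EReal.coe_le_coe_iff.2 hz.1),
    (EReal.coe_le_coe_iff.2 hz.2).trans_lt hy.2⟩⟩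

/-- Two solutions of an autonomous `C¹` differential equation on an open interval which agree at
one time agree at all times. -/
lemma solution_eq_of_eq {f : ℂ → ℂ} (hf : ContDiff ℝ 1 f) {J : Set ℝ} (hJo : IsOpen J)
    (hJ : J.OrdConnected) {z y : ℝ → ℂ} (hz : ∀ t ∈ J, HasDerivAt z (f (z t)) t)
    (hy : ∀ t ∈ J, HasDerivAt y (f (y t)) t) {s t : ℝ} (hs : s ∈ J) (ht : t ∈ J)
    (h : z s = y s) : z t = y t := by
  refine (hJ.isPreconnected.induction₂ (fun s t => z s = y s ↔ z t = y t) ?_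
    (fun _ _ _ _ _ _ h₁ h₂ => h₁.trans h₂) (fun _ _ _ _ h => h.symm) hs ht).1 h
  intro s hs
  refine Filter.Eventually.filter_mono nhdsWithin_le_nhds ?_
  by_cases h : z s = y s
  · obtain ⟨K, U, hU, hK⟩ := (hf.contDiffAt (x := z s)).exists_lipschitzOnWith
    have hJs : ∀ᶠ t in 𝓝 s, t ∈ J := hJo.mem_nhds hs
    have h1 : ∀ᶠ t in 𝓝 s, z t ∈ U := (hz s hs).continuousAt hU
    have h2 : ∀ᶠ t in 𝓝 s, y t ∈ U := (hy s hs).continuousAt (by rwa [← h])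
    have key : z =ᶠ[𝓝 s] y := by
      refine ODE_solution_unique_of_eventually (v := fun _ => f) (s := fun _ => U) (K := K)
        (Eventually.of_forall fun _ => hK) ?_ ?_ h
      · filter_upwards [hJs, h1] with t ht ht1 using ⟨hz t ht, ht1⟩
      · filter_upwards [hJs, h2] with t ht ht1 using ⟨hy t ht, ht1⟩
    filter_upwards [key] with t ht
    simp [h, ht]
  · filter_upwards [(hz s hs).continuousAt.ne_iff_eventually_ne (hy s hs).continuousAt |>.1 h]
      with t ht
    simp [h, ht]

/-- `z` on `(a, b)` solves `ż = f(z)`, `z(0) = w`, and `(a, b)` contains the interval of every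
solution of this initial value problem. -/
def MaxFlowFrom (f : ℂ → ℂ) (w : ℂ) (a b : EReal) (z : ℝ → ℂ) : Prop :=
  0 ∈ flowTimes a b ∧ z 0 = w ∧ FlowSol f a b z ∧
    ∀ (a' b' : EReal) (y : ℝ → ℂ), FlowSol f a' b' y → 0 ∈ flowTimes a' b' → y 0 = w →
      a ≤ a' ∧ b' ≤ b

lemma FlowSol.eqOn {f : ℂ → ℂ} (hf : ContDiff ℝ 1 f) {a b a' b' : EReal} {z y : ℝ → ℂ}
    (hz : FlowSol f a b z) (hy : FlowSol f a' b' y) {s t : ℝ} (hs : s ∈ flowTimes a b)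
    (hs' : s ∈ flowTimes a' b') (ht : t ∈ flowTimes a b) (ht' : t ∈ flowTimes a' b')
    (h : z s = y s) : z t = y t :=
  solution_eq_of_eq hf ((isOpen_flowTimes a b).inter (isOpen_flowTimes a' b'))
    ((ordConnected_flowTimes a b).inter (ordConnected_flowTimes a' b'))
    (fun t ht => hz.2 t ht.1.1 ht.1.2) (fun t ht => hy.2 t ht.2.1 ht.2.2) ⟨hs, hs'⟩ ⟨ht, ht'⟩ h

lemma flowTimes_coe (a b : ℝ) : flowTimes a b = Ioo a b := by
  ext t
  simp [flowTimes]

lemma exists_maxFlowFrom {f : ℂ → ℂ} (hf : ContDiff ℝ 1 f) (w : ℂ) :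
    ∃ (a b : EReal) (z : ℝ → ℂ), MaxFlowFrom f w a b z := by
  let 𝒮 : Set (EReal × EReal × (ℝ → ℂ)) :=
    {p | FlowSol f p.1 p.2.1 p.2.2 ∧ 0 ∈ flowTimes p.1 p.2.1 ∧ p.2.2 0 = w}
  obtain ⟨z₀, hz₀, ε, hε, hd⟩ := (hf.contDiffAt (x := w)
    ).exists_forall_mem_closedBall_exists_eq_forall_mem_Ioo_hasDerivAt₀ 0
  have hmem₀ : (((-ε : ℝ) : EReal), ((ε : ℝ) : EReal), z₀) ∈ 𝒮 := by
    refine ⟨⟨EReal.coe_lt_coe_iff.2 (by linarith), fun t h1 h2 => hd t ?_⟩, ?_, hz₀⟩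
    · rw [EReal.coe_lt_coe_iff] at h1 h2
      constructor <;> linarith
    · change (0 : ℝ) ∈ flowTimes ((-ε : ℝ) : EReal) (ε : EReal)
      rw [flowTimes_coe]
      constructor <;> linarith
  let A : EReal := sInf (Prod.fst '' 𝒮)
  let B : EReal := sSup ((fun p => p.2.1) '' 𝒮)
  have hA : ∀ p ∈ 𝒮, A ≤ p.1 := fun p hp => sInf_le (mem_image_of_mem _ hp)
  have hB : ∀ p ∈ 𝒮, p.2.1 ≤ B := fun p hp => le_sSup (mem_image_of_mem _ hp)
  have hex : ∀ t : ℝ, ∃ p : EReal × EReal × (ℝ → ℂ),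
      t ∈ flowTimes A B → p ∈ 𝒮 ∧ t ∈ flowTimes p.1 p.2.1 := by
    intro t
    by_cases ht : t ∈ flowTimes A B
    · rcases le_total 0 t with h0 | h0
      · obtain ⟨_, ⟨p, hp, rfl⟩, hlt⟩ := lt_sSup_iff.1 ht.2
        exact ⟨p, fun _ => ⟨hp, hp.2.1.1.trans_le (EReal.coe_le_coe_iff.2 h0), hlt⟩⟩
      · obtain ⟨_, ⟨p, hp, rfl⟩, hlt⟩ := sInf_lt_iff.1 ht.1
        exact ⟨p, fun _ => ⟨hp, hlt, (EReal.coe_le_coe_iff.2 h0).trans_lt hp.2.1.2⟩⟩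
    · exact ⟨(0, 0, 0), fun h => absurd h ht⟩
  choose P hP using hex
  have h0AB : (0 : ℝ) ∈ flowTimes A B :=
    ⟨(hA _ hmem₀).trans_lt hmem₀.2.1.1, hmem₀.2.1.2.trans_le (hB _ hmem₀)⟩
  refine ⟨A, B, fun t => (P t).2.2 t, h0AB, (hP 0 h0AB).1.2.2,
    ⟨h0AB.1.trans h0AB.2, fun t h1 h2 => ?_⟩, fun a' b' y hy h0 hyw =>
      ⟨hA (a', b', y) ⟨hy, h0, hyw⟩, hB (a', b', y) ⟨hy, h0, hyw⟩⟩⟩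
  obtain ⟨hpS, hpt⟩ := hP t ⟨h1, h2⟩
  refine (hpS.1.2 t hpt.1 hpt.2).congr_of_eventuallyEq ?_
  filter_upwards [(isOpen_flowTimes _ _).mem_nhds hpt] with s hs
  obtain ⟨hqS, hqs⟩ := hP s ⟨(hA _ hpS).trans_lt hs.1, hs.2.trans_le (hB _ hpS)⟩
  exact hqS.1.eqOn hf hpS.1 hqS.2.1 hpS.2.1 hqs hs (hqS.2.2.trans hpS.2.2.symm)

lemma MaxFlowFrom.maxFlowSol {f : ℂ → ℂ} {w : ℂ} {a b : EReal} {z : ℝ → ℂ}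
    (h : MaxFlowFrom f w a b z) : MaxFlowSol f a b z := by
  obtain ⟨h0, hw, hsol, hmax⟩ := h
  refine ⟨hsol, fun a' b' y hy ha hb hyz => ?_⟩
  have := hmax a' b' y hy ⟨ha.trans_lt h0.1, h0.2.trans_le hb⟩ ((hyz 0 h0.1 h0.2).trans hw)
  exact ⟨le_antisymm ha this.1, le_antisymm this.2 hb⟩

lemma FlowSol.comp_add_const {f : ℂ → ℂ} {a b : EReal} {z : ℝ → ℂ} (h : FlowSol f a b z)
    (c : ℝ) : FlowSol f (a - c) (b - c) (fun t => z (t + c)) := by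
  refine ⟨EReal.sub_lt_sub_of_lt_of_le h.1 le_rfl (by simp) (by simp), fun t h1 h2 => ?_⟩
  refine HasDerivAt.comp_add_const t c (h.2 (t + c) ?_ ?_)
  · rw [EReal.sub_lt_iff (by simp) (by simp)] at h1
    simpa using h1
  · rw [EReal.lt_sub_iff_add_lt (by simp) (by simp)] at h2
    simpa using h2

lemma mem_flowTimes_sub_iff {a b : EReal} {t c : ℝ} :
    t ∈ flowTimes (a - c) (b - c) ↔ t + c ∈ flowTimes a b := by
  unfold flowTimes
  simp only [mem_ofPred_eq]
  rw [EReal.sub_lt_iff (by simp) (by simp), EReal.lt_sub_iff_add_lt (by simp) (by simp)]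
  simp

/-- A solution passing through `x` at time `c` is, after a time shift, part of the maximal
solution starting at `x`. -/
lemma MaxFlowFrom.shift {f : ℂ → ℂ} (hf : ContDiff ℝ 1 f) {x : ℂ} {a b a' b' : EReal}
    {z y : ℝ → ℂ} (hz : MaxFlowFrom f x a b z) (hy : FlowSol f a' b' y) {c : ℝ}
    (hc : c ∈ flowTimes a' b') (hx : y c = x) {t : ℝ} (ht : t + c ∈ flowTimes a' b') :
    t ∈ flowTimes a b ∧ z t = y (t + c) := by
  obtain ⟨h0, hw, hsol, hmax⟩ := hz
  have h0' : 0 ∈ flowTimes (a' - c) (b' - c) := mem_flowTimes_sub_iff.2 (by simpa using hc)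
  obtain ⟨h1, h2⟩ := hmax _ _ _ (hy.comp_add_const c) h0' (by simpa using hx)
  have ht' := mem_flowTimes_sub_iff.2 ht
  have htm : t ∈ flowTimes a b := ⟨h1.trans_lt ht'.1, ht'.2.trans_le h2⟩
  exact ⟨htm, hsol.eqOn hf (hy.comp_add_const c) h0 h0' htm ht' (by simp [hw, hx])⟩

/-- A maximal solution with finite final time tends to infinity. -/
lemma MaxFlowSol.tendsto_cobounded {f : ℂ → ℂ} (hf : ContDiff ℝ 1 f) {a : EReal} {c : ℝ}
    {z : ℝ → ℂ} (h : MaxFlowSol f a c z) : Tendsto z (𝓝[<] c) (Bornology.cobounded ℂ) := by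
  by_contra hcon
  obtain ⟨hsol, hmax⟩ := h
  rw [← tendsto_norm_atTop_iff_cobounded, tendsto_atTop] at hcon
  push Not at hcon
  obtain ⟨r, hr⟩ := hcon
  obtain ⟨p, -, hp⟩ := (isCompact_closedBall (0 : ℂ) r).exists_mapClusterPt_of_frequently
    (l := 𝓝[<] c) (f := z) (hr.mono fun t ht => by simpa using ht.le)
  obtain ⟨ρ, hρ, ε, hε, hloc⟩ := (hf.contDiffAt (x := p)
    ).exists_forall_mem_closedBall_exists_eq_forall_mem_Ioo_hasDerivAt 0
  have hfreq := mapClusterPt_iff_frequently.1 hp _ (Metric.closedBall_mem_nhds p hρ)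
  have hev : ∀ᶠ t : ℝ in 𝓝[<] c, a < (t : EReal) ∧ t < c ∧ c - ε < t := by
    have h1 : ∀ᶠ t : ℝ in 𝓝 c, a < (t : EReal) :=
      (isOpen_Ioi.preimage continuous_coe_real_ereal).mem_nhds hsol.1
    have h2 : ∀ᶠ t : ℝ in 𝓝 c, c - ε < t := lt_mem_nhds (by linarith)
    filter_upwards [nhdsWithin_le_nhds h1, nhdsWithin_le_nhds h2, self_mem_nhdsWithin]
      with t h1 h2 h3 using ⟨h1, h3, h2⟩
  obtain ⟨t₁, hzt, ha, htc, hct⟩ := (hfreq.and_eventually hev).exists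
  obtain ⟨α, hα0, hα⟩ := hloc _ hzt
  have hy : ∀ t ∈ Ioo (t₁ - ε) (t₁ + ε), HasDerivAt (fun t => α (t - t₁)) (f (α (t - t₁))) t :=
    fun t ht => HasDerivAt.comp_sub_const t t₁
      (hα (t - t₁) ⟨by linarith [ht.1], by linarith [ht.2]⟩)
  have heq : ∀ t ∈ Ioo (t₁ - ε) (t₁ + ε) ∩ flowTimes a c, z t = α (t - t₁) := fun t ht =>
    solution_eq_of_eq hf (isOpen_Ioo.inter (isOpen_flowTimes a c))
      (ordConnected_Ioo.inter (ordConnected_flowTimes a c))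
      (fun t ht => hsol.2 t ht.2.1 ht.2.2) (fun t ht => hy t ht.1)
      (s := t₁) ⟨⟨by linarith, by linarith⟩, ha, EReal.coe_lt_coe_iff.2 htc⟩ ht (by simp [hα0])
  have hc' : (c : EReal) < ((t₁ + ε : ℝ) : EReal) := EReal.coe_lt_coe_iff.2 (by linarith)
  have := hmax a ((t₁ + ε : ℝ) : EReal) (fun t => if t < c then z t else α (t - t₁))
    ⟨hsol.1.trans hc', fun t h1 h2 => ?_⟩ le_rfl hc'.le
    (fun t _ h2 => if_pos (EReal.coe_lt_coe_iff.1 h2))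
  · exact absurd this.2 hc'.ne'
  · rw [EReal.coe_lt_coe_iff] at h2
    by_cases htc' : t < c
    · simp only [htc', if_true]
      refine (hsol.2 t h1 (EReal.coe_lt_coe_iff.2 htc')).congr_of_eventuallyEq ?_
      filter_upwards [gt_mem_nhds htc'] with s hs using if_pos hs
    · simp only [htc', if_false]
      have htm : t ∈ Ioo t₁ (t₁ + ε) := ⟨by linarith [not_lt.1 htc'], h2⟩
      refine (hy t ⟨by linarith [htm.1], h2⟩).congr_of_eventuallyEq ?_
      filter_upwards [isOpen_Ioo.mem_nhds htm] with s hs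
      split_ifs with hsc
      · exact heq s ⟨⟨by linarith [hs.1], hs.2⟩, ha.trans (EReal.coe_lt_coe_iff.2 hs.1),
          EReal.coe_lt_coe_iff.2 hsc⟩
      · rfl

end MaximalSolutions

section PolynomialFlow

open scoped Topology

lemma exists_polynomial_eq_antiderivative (g : Polynomial ℂ) (G : ℂ → ℂ)
    (hG : ∀ z : ℂ, HasDerivAt G (g.eval z) z) :
    ∃ P : Polynomial ℂ, P.derivative = g ∧ ∀ z, G z = P.eval z := by
  let Q : Polynomial ℂ :=
    ∑ i ∈ g.support, Polynomial.monomial (i + 1) (g.coeff i / ((i : ℂ) + 1))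
  have hQ : Q.derivative = g := by
    conv_rhs => rw [g.as_sum_support]
    simp only [Q, Polynomial.derivative_sum, Polynomial.derivative_monomial]
    refine Finset.sum_congr rfl fun i _ => ?_
    have : (i : ℂ) + 1 ≠ 0 := by exact_mod_cast i.succ_ne_zero
    simp [div_mul_cancel₀ _ this]
  refine ⟨Q + Polynomial.C (G 0 - Q.eval 0), by simp [hQ], fun z => ?_⟩
  have hd : ∀ z, HasDerivAt (fun z => G z - Q.eval z) 0 z := fun z => by
    have := (hG z).sub (Q.hasDerivAt z)
    rwa [hQ, sub_self] at this
  have := is_const_of_deriv_eq_zero (fun z => (hd z).differentiableAt) (fun z => (hd z).deriv) z 0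
  simp only [Polynomial.eval_add, Polynomial.eval_C]
  linear_combination this

lemma surjective_antiderivative (g : Polynomial ℂ) (hg : g ≠ 0) (G : ℂ → ℂ)
    (hG : ∀ z : ℂ, HasDerivAt G (g.eval z) z) : Function.Surjective G := by
  obtain ⟨P, hP, hGP⟩ := exists_polynomial_eq_antiderivative g G hG
  intro v
  have hdeg : (P - Polynomial.C v).degree ≠ 0 := by
    intro h
    rw [Polynomial.eq_C_of_degree_eq_zero h |> sub_eq_iff_eq_add.1] at hP
    simp at hP
    exact hg hP.symm
  obtain ⟨x, hx⟩ := IsAlgClosed.exists_root _ hdeg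
  refine ⟨x, ?_⟩
  rw [hGP]
  simpa [sub_eq_zero] using hx

lemma exists_growth_bound (g : Polynomial ℂ) (hdeg : 2 ≤ g.natDegree) (G : ℂ → ℂ)
    (hG : ∀ z : ℂ, HasDerivAt G (g.eval z) z) :
    ∃ R₀ > 0, ∃ k > 0, ∀ z, R₀ ≤ ‖G z‖ → ‖G z‖ ^ 4 ≤ (k * ‖g.eval z‖ ^ 2) ^ 3 := by
  obtain ⟨P, hP, hGP⟩ := exists_polynomial_eq_antiderivative g G hG
  have hg : g ≠ 0 := by
    rintro rfl
    simp at hdeg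
  have hdP : P.natDegree ≤ g.natDegree + 1 := by
    have := Polynomial.natDegree_derivative (p := P)
    rw [hP] at this
    omega
  have hle : (P ^ 2).degree ≤ (g ^ 3).degree := by
    refine Polynomial.degree_le_of_natDegree_le ?_ |>.trans
      (Polynomial.degree_eq_natDegree (pow_ne_zero 3 hg)).ge
    rw [Polynomial.natDegree_pow, Polynomial.natDegree_pow]
    omega
  obtain ⟨C, hC⟩ := (Polynomial.isBigO_cobounded_of_degree_le hle).bound
  rw [← comap_norm_atTop, eventually_comap] at hC
  obtain ⟨r, hr⟩ := eventually_atTop.1 hC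
  obtain ⟨M, hM⟩ := (isCompact_closedBall (0 : ℂ) r).exists_bound_of_continuousOn
    (f := G) (fun z _ => (hG z).continuousAt.continuousWithinAt)
  refine ⟨max M 0 + 1, by positivity, C ^ 2 + 1, by positivity, fun z hz => ?_⟩
  have hzr : r ≤ ‖z‖ := by
    by_contra h
    have := hM z (by simpa using (not_le.1 h).le)
    linarith [le_max_left M 0]
  have h1 := hr _ hzr z rfl
  simp only [Polynomial.eval_pow, norm_pow, ← hGP] at h1
  have hk : C ^ 2 ≤ (C ^ 2 + 1) ^ 3 := by nlinarith [sq_nonneg C, sq_nonneg (C ^ 2)]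
  calc ‖G z‖ ^ 4 = (‖G z‖ ^ 2) ^ 2 := by ring
    _ ≤ (C * ‖g.eval z‖ ^ 3) ^ 2 := by gcongr
    _ = C ^ 2 * ‖g.eval z‖ ^ 6 := by ring
    _ ≤ (C ^ 2 + 1) ^ 3 * ‖g.eval z‖ ^ 6 := by gcongr
    _ = _ := by ring

/-- A positive function with `u ^ (4 / 3) ≤ k * u'` cannot exist for all positive times. -/
lemma false_of_superlinear_growth {u u' : ℝ → ℝ} {k : ℝ} (hk : 0 < k)
    (hd : ∀ t, 0 ≤ t → HasDerivAt u (u' t) t) (hu : ∀ t, 0 ≤ t → 0 < u t)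
    (hu' : ∀ t, 0 ≤ t → 0 ≤ u' t) (h : ∀ t, 0 ≤ t → u t ^ 4 ≤ (k * u' t) ^ 3) : False := by
  have hpow : ∀ t, 0 ≤ t → u t ^ ((4 : ℝ) / 3) ≤ k * u' t := fun t ht => by
    have h0 : 0 ≤ k * u' t := mul_nonneg hk.le (hu' t ht)
    refine le_of_pow_le_pow_left₀ (n := 3) (by norm_num) h0 ?_
    rw [← Real.rpow_natCast, ← Real.rpow_mul (hu t ht).le]
    norm_num
    exact_mod_cast h t ht
  let v : ℝ → ℝ := fun t => u t ^ (-(1 : ℝ) / 3) + t / (3 * k)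
  have hv : ∀ t, 0 ≤ t → HasDerivAt v
      (u' t * (-(1 : ℝ) / 3) * u t ^ (-(1 : ℝ) / 3 - 1) + 1 / (3 * k)) t := fun t ht =>
    ((hd t ht).rpow_const (Or.inl (hu t ht).ne')).add ((hasDerivAt_id t).div_const _)
  have hv' : ∀ t, 0 ≤ t →
      u' t * (-(1 : ℝ) / 3) * u t ^ (-(1 : ℝ) / 3 - 1) + 1 / (3 * k) ≤ 0 := fun t ht => by
    have hp : 0 < u t ^ ((4 : ℝ) / 3) := Real.rpow_pos_of_pos (hu t ht) _
    have he : u t ^ (-(1 : ℝ) / 3 - 1) = (u t ^ ((4 : ℝ) / 3))⁻¹ := by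
      rw [← Real.rpow_neg (hu t ht).le]
      norm_num
    have h1 : 1 / k ≤ u' t * (u t ^ ((4 : ℝ) / 3))⁻¹ := by
      rw [← div_eq_mul_inv, div_le_div_iff₀ hk hp]
      linarith [hpow t ht]
    have h2 : 1 / (3 * k) = 1 / 3 * (1 / k) := by field_simp
    rw [he, h2]
    linarith
  have hanti : AntitoneOn v (Ici 0) := antitoneOn_of_deriv_nonpos (convex_Ici 0)
    (fun t ht => (hv t ht).continuousAt.continuousWithinAt)
    (fun t ht => (hv t (interior_subset ht)).differentiableAt.differentiableWithinAt)
    (fun t ht => (hv t (interior_subset ht)).deriv.trans_le (hv' t (interior_subset ht)))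
  have hv0 : 0 < v 0 := by
    have := Real.rpow_pos_of_pos (hu 0 le_rfl) (-(1 : ℝ) / 3)
    simpa [v] using this
  have hT : (0 : ℝ) ≤ 3 * k * v 0 := by positivity
  have hle := hanti (mem_Ici.2 le_rfl) (mem_Ici.2 hT) hT
  have hpos := Real.rpow_pos_of_pos (hu _ hT) (-(1 : ℝ) / 3)
  have hdiv : 3 * k * v 0 / (3 * k) = v 0 := by field_simp
  have : v (3 * k * v 0) = u (3 * k * v 0) ^ (-(1 : ℝ) / 3) + v 0 := by
    simp only [v] at hdiv ⊢
    rw [hdiv]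
  linarith

variable {g : Polynomial ℂ} {G : ℂ → ℂ}

lemma contDiff_conj_eval (g : Polynomial ℂ) :
    ContDiff ℝ 1 (fun w : ℂ => (starRingEnd ℂ) (g.eval w)) :=
  Complex.conjCLE.contDiff.comp ((g.differentiable (𝕜 := ℂ)).contDiff.restrict_scalars ℝ)

lemma FlowSol.hasDerivAt_antiderivative (hG : ∀ z : ℂ, HasDerivAt G (g.eval z) z) {a b : EReal}
    {z : ℝ → ℂ} (hz : FlowSol (fun w => (starRingEnd ℂ) (g.eval w)) a b z) {t : ℝ}
    (ht : t ∈ flowTimes a b) :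
    HasDerivAt (fun t => G (z t)) ((‖g.eval (z t)‖ ^ 2 : ℝ) : ℂ) t := by
  have := (hG (z t)).comp t (hz.2 t ht.1 ht.2)
  rw [Complex.mul_conj, Complex.normSq_eq_norm_sq] at this
  exact this

lemma FlowSol.hasDerivAt_re (hG : ∀ z : ℂ, HasDerivAt G (g.eval z) z) {a b : EReal}
    {z : ℝ → ℂ} (hz : FlowSol (fun w => (starRingEnd ℂ) (g.eval w)) a b z) {t : ℝ}
    (ht : t ∈ flowTimes a b) :
    HasDerivAt (fun t => (G (z t)).re) (‖g.eval (z t)‖ ^ 2) t := by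
  have := Complex.reCLM.hasFDerivAt.comp_hasDerivAt t (hz.hasDerivAt_antiderivative hG ht)
  simp only [Complex.reCLM_apply, Complex.ofReal_re] at this
  exact this

lemma FlowSol.hasDerivAt_im (hG : ∀ z : ℂ, HasDerivAt G (g.eval z) z) {a b : EReal}
    {z : ℝ → ℂ} (hz : FlowSol (fun w => (starRingEnd ℂ) (g.eval w)) a b z) {t : ℝ}
    (ht : t ∈ flowTimes a b) :
    HasDerivAt (fun t => (G (z t)).im) 0 t := by
  have := Complex.imCLM.hasFDerivAt.comp_hasDerivAt t (hz.hasDerivAt_antiderivative hG ht)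
  simp only [Complex.imCLM_apply, Complex.ofReal_im] at this
  exact this

lemma FlowSol.im_eq (hG : ∀ z : ℂ, HasDerivAt G (g.eval z) z) {a b : EReal}
    {z : ℝ → ℂ} (hz : FlowSol (fun w => (starRingEnd ℂ) (g.eval w)) a b z) {s t : ℝ}
    (hs : s ∈ flowTimes a b) (ht : t ∈ flowTimes a b) : (G (z s)).im = (G (z t)).im :=
  (isOpen_flowTimes a b).is_const_of_deriv_eq_zero (ordConnected_flowTimes a b).isPreconnected
    (f := fun t => (G (z t)).im)
    (fun _ h => (hz.hasDerivAt_im hG h).differentiableAt.differentiableWithinAt)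
    (fun _ h => (hz.hasDerivAt_im hG h).deriv) hs ht

lemma FlowSol.monotoneOn_re (hG : ∀ z : ℂ, HasDerivAt G (g.eval z) z) {a b : EReal}
    {z : ℝ → ℂ} (hz : FlowSol (fun w => (starRingEnd ℂ) (g.eval w)) a b z) :
    MonotoneOn (fun t => (G (z t)).re) (flowTimes a b) :=
  monotoneOn_of_deriv_nonneg (ordConnected_flowTimes a b).convex
    (fun _ h => (hz.hasDerivAt_re hG h).continuousAt.continuousWithinAt)
    (fun _ h => (hz.hasDerivAt_re hG (interior_subset h)).differentiableAt.differentiableWithinAt)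
    (fun _ h => (hz.hasDerivAt_re hG (interior_subset h)).deriv.symm ▸ by positivity)

/-- Maximal solutions starting where `G` has large real part escape in finite time. -/
lemma MaxFlowFrom.escapesInFiniteTime (hG : ∀ z : ℂ, HasDerivAt G (g.eval z) z) {R₀ k : ℝ}
    (hR₀ : 0 < R₀) (hk : 0 < k)
    (hgrowth : ∀ z, R₀ ≤ ‖G z‖ → ‖G z‖ ^ 4 ≤ (k * ‖g.eval z‖ ^ 2) ^ 3) {w : ℂ}
    (hw : R₀ ≤ (G w).re) {a b : EReal} {z : ℝ → ℂ}
    (h : MaxFlowFrom (fun w => (starRingEnd ℂ) (g.eval w)) w a b z) :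
    EscapesInFiniteTime (fun w => (starRingEnd ℂ) (g.eval w)) a b z := by
  obtain ⟨h0, hz0, hsol, -⟩ := id h
  refine ⟨h.maxFlowSol, ?_⟩
  have hb : b ≠ ⊤ := by
    rintro rfl
    have hmem : ∀ t : ℝ, 0 ≤ t → t ∈ flowTimes a ⊤ := fun t ht =>
      ⟨h0.1.trans_le (EReal.coe_le_coe_iff.2 ht), EReal.coe_lt_top t⟩
    have hre : ∀ t : ℝ, 0 ≤ t → R₀ ≤ (G (z t)).re := fun t ht => by
      have := hsol.monotoneOn_re hG h0 (hmem t ht) ht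
      simp only [hz0] at this
      exact hw.trans this
    refine false_of_superlinear_growth hk (fun t ht => hsol.hasDerivAt_re hG (hmem t ht))
      (fun t ht => hR₀.trans_le (hre t ht)) (fun t _ => by positivity) (fun t ht => ?_)
    have hn : (G (z t)).re ≤ ‖G (z t)‖ := Complex.re_le_norm _
    have h1 : 0 ≤ (G (z t)).re := hR₀.le.trans (hre t ht)
    exact (pow_le_pow_left₀ h1 hn 4).trans (hgrowth _ ((hre t ht).trans hn))
  lift b to ℝ using ⟨hb, ((EReal.bot_lt_coe 0).trans h0.2).ne'⟩
  exact ⟨b, rfl, h.maxFlowSol.tendsto_cobounded (contDiff_conj_eval g)⟩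

/-- Near a noncritical point `p`, the level set of `Im G` through `p` is part of the trajectory
through `p`. -/
lemma FlowSol.eventually_mem_traj (hG : ∀ z : ℂ, HasDerivAt G (g.eval z) z) {a b : EReal}
    {z : ℝ → ℂ} (hz : FlowSol (fun w => (starRingEnd ℂ) (g.eval w)) a b z)
    (h0 : 0 ∈ flowTimes a b) (hg : g.eval (z 0) ≠ 0) :
    ∀ᶠ q in 𝓝 (z 0), (G q).im = (G (z 0)).im → ∃ t ∈ flowTimes a b, z t = q := by
  have hJ : ∀ᶠ t in 𝓝 (0 : ℝ), t ∈ flowTimes a b := (isOpen_flowTimes a b).mem_nhds h0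
  have hGs : HasStrictDerivAt G (g.eval (z 0)) (z 0) :=
    hasStrictDerivAt_of_hasDerivAt_of_continuousAt (f' := fun w => g.eval w)
      (Eventually.of_forall hG) g.continuous.continuousAt
  have hinv := hGs.eventually_left_inverse hg
  have hzc : ContinuousAt z 0 := (hz.2 0 h0.1 h0.2).continuousAt
  have hus : HasStrictDerivAt (fun t => (G (z t)).re) (‖g.eval (z 0)‖ ^ 2) 0 :=
    hasStrictDerivAt_of_hasDerivAt_of_continuousAt (f' := fun t => ‖g.eval (z t)‖ ^ 2)
      (hJ.mono fun t ht => hz.hasDerivAt_re hG ht)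
      ((g.continuous.continuousAt.comp hzc).norm.pow 2)
  have hmap := hus.map_nhds_eq (by positivity)
  have hgood : ∀ᶠ s in 𝓝 (G (z 0)).re, ∃ t, (t ∈ flowTimes a b ∧
      hGs.localInverse G _ _ hg (G (z t)) = z t) ∧ (G (z t)).re = s := by
    rw [← hmap]
    refine mem_of_superset (image_mem_map (hJ.and (hzc.eventually hinv))) ?_
    rintro _ ⟨t, ht, rfl⟩
    exact ⟨t, ht, rfl⟩
  have hre : ContinuousAt (fun q => (G q).re) (z 0) :=
    Complex.continuous_re.continuousAt.comp (hG (z 0)).continuousAt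
  filter_upwards [hre.eventually hgood, hinv] with q ⟨t, ⟨ht, hti⟩, htq⟩ hq him
  refine ⟨t, ht, ?_⟩
  have : G (z t) = G q := Complex.ext htq ((hz.im_eq hG ht h0).trans him.symm)
  rw [← hti, this, hq]

/-- A connected subset of a level set of `Im G` without critical points is contained in a single
trajectory. -/
lemma subset_traj_of_isPreconnected (hG : ∀ z : ℂ, HasDerivAt G (g.eval z) z) {C : Set ℂ}
    (hC : IsPreconnected C) {S : ℝ} (him : ∀ q ∈ C, (G q).im = S)
    (hg : ∀ q ∈ C, g.eval q ≠ 0) {w : ℂ} (hw : w ∈ C) {a b : EReal} {z : ℝ → ℂ}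
    (hz : MaxFlowFrom (fun w => (starRingEnd ℂ) (g.eval w)) w a b z) : C ⊆ Traj a b z := by
  have hf := contDiff_conj_eval g
  choose A B Z hZ using exists_maxFlowFrom hf
  intro q hq
  have key : ∃ t ∈ flowTimes (A w) (B w), Z w t = q := by
    refine hC.induction₂ (fun x y => ∃ t ∈ flowTimes (A x) (B x), Z x t = y) ?_ ?_ ?_ hw hq
    · intro x hx
      obtain ⟨h0, hx0, hsol, -⟩ := hZ x
      have := hsol.eventually_mem_traj hG h0 (hx0.symm ▸ hg x hx)
      rw [hx0] at this
      filter_upwards [nhdsWithin_le_nhds this, self_mem_nhdsWithin] with y hy hyC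
      exact hy ((him y hyC).trans (him x hx).symm)
    · rintro x y v - - - ⟨t, ht, rfl⟩ ⟨s, hs, rfl⟩
      obtain ⟨h0, hx0, hsol, -⟩ := hZ x
      have h1 := (hZ (Z x t)).shift hf hsol ht rfl (t := -t) (by simpa using h0)
      have h2 := (hZ x).shift hf (hZ (Z x t)).2.2.1 h1.1 (by rw [h1.2]; simp [hx0])
        (t := s + t) (by simpa using hs)
      exact ⟨s + t, h2.1, by simpa using h2.2⟩
    · rintro x y - - ⟨t, ht, rfl⟩
      obtain ⟨h0, hx0, hsol, -⟩ := hZ x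
      have h1 := (hZ (Z x t)).shift hf hsol ht rfl (t := -t) (by simpa using h0)
      exact ⟨-t, h1.1, by rw [h1.2]; simp [hx0]⟩
  obtain ⟨t, ht, rfl⟩ := key
  have := hz.shift hf (hZ w).2.2.1 (hZ w).1 (hZ w).2.1 (t := t) (by simpa using ht)
  exact ⟨t, this.1, by simpa using this.2⟩

end PolynomialFlow

/-- For a polynomial `g` of degree `n ≥ 2` with antiderivative `G`, the antiholomorphic flow
`ż = conj (g z)` has uncountably many pairwise disjoint trajectories tending to infinity in
finite increasing time; moreover for each `S ∈ ℝ` and all sufficiently large `R`, each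
connected component of the pre-image under `G` of the half-line `{r + iS : r ≥ R}` is
traversed by such a trajectory. -/
theorem polynomial_antiholomorphic_flow_escaping_trajectories
    (g : Polynomial ℂ) (hdeg : 2 ≤ g.natDegree) (G : ℂ → ℂ)
    (hG : ∀ z : ℂ, HasDerivAt G (g.eval z) z) :
    (∃ (Z : ℝ → ℝ → ℂ) (A B : ℝ → EReal),
      (∀ Y : ℝ,
        EscapesInFiniteTime (fun w => (starRingEnd ℂ) (g.eval w)) (A Y) (B Y) (Z Y)) ∧
      Pairwise fun Y Y' =>
        Disjoint (Traj (A Y) (B Y) (Z Y)) (Traj (A Y') (B Y') (Z Y'))) ∧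
    ∀ S : ℝ, ∃ R₀ : ℝ, 0 < R₀ ∧ ∀ R : ℝ, R₀ ≤ R →
      ∀ w : ℂ, G w ∈ {v : ℂ | v.im = S ∧ R ≤ v.re} →
        ∃ (a b : EReal) (z : ℝ → ℂ),
          EscapesInFiniteTime (fun u => (starRingEnd ℂ) (g.eval u)) a b z ∧
          connectedComponentIn (G ⁻¹' {v : ℂ | v.im = S ∧ R ≤ v.re}) w ⊆ Traj a b z := by
  have hg0 : g ≠ 0 := by
    rintro rfl
    simp at hdeg
  have hf := contDiff_conj_eval g
  obtain ⟨R₀, hR₀, k, hk, hgrowth⟩ := exists_growth_bound g hdeg G hG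
  refine ⟨?_, fun S => ⟨R₀, hR₀, fun R hR w hw => ?_⟩⟩
  · choose w hw using fun Y : ℝ => surjective_antiderivative g hg0 G hG ⟨R₀, Y⟩
    choose A B Z hZ using fun Y : ℝ => exists_maxFlowFrom hf (w Y)
    have him : ∀ Y, ∀ x ∈ Traj (A Y) (B Y) (Z Y), (G x).im = Y := by
      rintro Y _ ⟨t, ht, rfl⟩
      obtain ⟨h0, hw0, hsol, -⟩ := hZ Y
      rw [hsol.im_eq hG ht h0, hw0, hw]
    refine ⟨Z, A, B, fun Y => (hZ Y).escapesInFiniteTime hG hR₀ hk hgrowth (by simp [hw]),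
      fun Y Y' hne => Set.disjoint_left.2 fun x hx hx' => hne ?_⟩
    rw [← him Y x hx, him Y' x hx']
  · obtain ⟨a, b, z, hz⟩ := exists_maxFlowFrom hf w
    have hsub := connectedComponentIn_subset (G ⁻¹' {v : ℂ | v.im = S ∧ R ≤ v.re}) w
    refine ⟨a, b, z, hz.escapesInFiniteTime hG hR₀ hk hgrowth (hR.trans hw.2),
      subset_traj_of_isPreconnected hG isPreconnected_connectedComponentIn
        (fun q hq => (hsub hq).1) (fun q hq hq0 => ?_) (mem_connectedComponentIn hw) hz⟩
    have h1 : R₀ ≤ ‖G q‖ := (hR.trans (hsub hq).2).trans (Complex.re_le_norm _)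
    have h2 := hgrowth q h1
    have h3 : 0 < ‖G q‖ ^ 4 := pow_pos (hR₀.trans_le h1) 4
    simp only [hq0] at h2
    norm_num at h2
    linarith
end
end

section
/- Let f be a polynomial in z of degree n ≥ 2. Then there exist n − 1 pairwise disjoint trajectories of the holomorphic flow ż = f(z) which tend to infinity in finite increasing time. -/
open Filter Set

noncomputable section

open scoped Topology

theorem FlowSol.congr {f : ℂ → ℂ} {a b : EReal} {z w : ℝ → ℂ} (hz : FlowSol f a b z)
    (h : ∀ t : ℝ, a < t → (t : EReal) < b → w t = z t) : FlowSol f a b w := by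
  refine ⟨hz.1, fun t h1 h2 => ?_⟩
  rw [h t h1 h2]
  refine (hz.2 t h1 h2).congr_of_eventuallyEq ?_
  filter_upwards [continuous_coe_real_ereal.continuousAt.eventually_const_lt h1,
    continuous_coe_real_ereal.continuousAt.eventually_lt_const h2] with τ h3 h4 using h τ h3 h4

theorem FlowSol.mono {f : ℂ → ℂ} {a b a' b' : EReal} {z : ℝ → ℂ} (hz : FlowSol f a b z)
    (ha : a ≤ a') (hb : b' ≤ b) (hab : a' < b') : FlowSol f a' b' z :=
  ⟨hab, fun t h1 h2 => hz.2 t (ha.trans_lt h1) (h2.trans_le hb)⟩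

/-- Two solutions of `ż = f(z)` with `f` continuously differentiable that agree at one time agree
on their whole common interval. -/
theorem FlowSol.eq_of_eq {f : ℂ → ℂ} (hf : ContDiff ℂ 1 f) {a b : EReal} {z w : ℝ → ℂ}
    (hz : FlowSol f a b z) (hw : FlowSol f a b w) {t₀ : ℝ} (h₁ : a < t₀) (h₂ : (t₀ : EReal) < b)
    (h : z t₀ = w t₀) (t : ℝ) (ht₁ : a < t) (ht₂ : (t : EReal) < b) : z t = w t := by
  have hopen : IsOpen {t : ℝ | a < t ∧ (t : EReal) < b} :=
    (isOpen_lt continuous_const continuous_coe_real_ereal).inter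
      (isOpen_lt continuous_coe_real_ereal continuous_const)
  have hconn : IsPreconnected {t : ℝ | a < t ∧ (t : EReal) < b} := by
    refine Set.OrdConnected.isPreconnected ⟨fun x hx y hy τ hτ => ⟨hx.1.trans_le ?_, ?_⟩⟩
    · exact_mod_cast hτ.1
    · exact lt_of_le_of_lt (by exact_mod_cast hτ.2) hy.2
  have hloc : ∀ τ ∈ {t : ℝ | a < t ∧ (t : EReal) < b}, z τ = w τ → z =ᶠ[𝓝 τ] w := by
    intro τ hτ heq
    obtain ⟨K, s, hs, hK⟩ := (hf.contDiffAt (x := z τ)).exists_lipschitzOnWith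
    refine ODE_solution_unique_of_eventually (v := fun _ => f) (s := fun _ => s) (K := K)
      (Eventually.of_forall fun _ => hK) ?_ ?_ heq
    · filter_upwards [hopen.mem_nhds hτ, (hz.2 τ hτ.1 hτ.2).continuousAt hs] with σ h1 h2
      exact ⟨hz.2 σ h1.1 h1.2, h2⟩
    · rw [heq] at hs
      filter_upwards [hopen.mem_nhds hτ, (hw.2 τ hτ.1 hτ.2).continuousAt hs] with σ h1 h2
      exact ⟨hw.2 σ h1.1 h1.2, h2⟩
  have hsub : {t : ℝ | a < t ∧ (t : EReal) < b} ⊆ {τ : ℝ | z =ᶠ[𝓝 τ] w} := by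
    refine hconn.subset_of_closure_inter_subset isOpen_setOfPred_eventually_nhds
      ⟨t₀, ⟨h₁, h₂⟩, hloc t₀ ⟨h₁, h₂⟩ h⟩ ?_
    rintro τ ⟨hcl, hτ⟩
    refine hloc τ hτ ?_
    by_contra hne
    have hne' := (hz.2 τ hτ.1 hτ.2).continuousAt.ne_iff_eventually_ne
      (hw.2 τ hτ.1 hτ.2).continuousAt |>.1 hne
    obtain ⟨σ, h1, h2⟩ := ((mem_closure_iff_frequently.1 hcl).and_eventually hne').exists
    exact h2 h1.self_of_nhds
  exact (hsub ⟨ht₁, ht₂⟩).self_of_nhds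

theorem ContinuousAt.not_tendsto_cobounded_nhdsLT {w : ℝ → ℂ} {c : ℝ} (hw : ContinuousAt w c) :
    ¬ Tendsto w (𝓝[<] c) (Bornology.cobounded ℂ) := fun h =>
  (hw.tendsto.mono_left nhdsWithin_le_nhds).not_tendsto (Metric.disjoint_nhds_cobounded _) h

/-- A solution blowing up at time `c` extends backwards to a maximal one. -/
theorem FlowSol.exists_escapesInFiniteTime {f : ℂ → ℂ} (hf : ContDiff ℂ 1 f) {a : EReal} {c : ℝ}
    {z : ℝ → ℂ} (hz : FlowSol f a c z) (hlim : Tendsto z (𝓝[<] c) (Bornology.cobounded ℂ)) :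
    ∃ (A : EReal) (Z : ℝ → ℂ), EscapesInFiniteTime f A c Z ∧
      ∀ t : ℝ, a < t → t < c → Z t = z t := by
  obtain ⟨t₀, h₁, h₂⟩ := EReal.lt_iff_exists_real_btwn.1 hz.1
  let S : Set EReal := {a' | a' ≤ a ∧ ∃ w, FlowSol f a' c w ∧
    ∀ t : ℝ, a < t → (t : EReal) < c → w t = z t}
  have haS : a ∈ S := ⟨le_rfl, z, hz, fun _ _ _ => rfl⟩
  have hAa : sInf S ≤ a := sInf_le haS
  have hex : ∀ t : ℝ, ∃ a' w, sInf S < t → a' < (t : EReal) ∧ a' ≤ a ∧ FlowSol f a' c w ∧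
      ∀ t : ℝ, a < t → (t : EReal) < c → w t = z t := by
    intro t
    by_cases ht : sInf S < t
    · obtain ⟨a', ⟨h1, w, h2⟩, h3⟩ := sInf_lt_iff.1 ht
      exact ⟨a', w, fun _ => ⟨h3, h1, h2⟩⟩
    · exact ⟨a, z, fun h => absurd h ht⟩
  choose α w hαw using hex
  let Z : ℝ → ℂ := fun t => w t t
  have hZ : ∀ (a' : EReal) (v : ℝ → ℂ), a' ≤ a → FlowSol f a' c v →
      (∀ t : ℝ, a < t → (t : EReal) < c → v t = z t) →
      ∀ t : ℝ, a' < t → (t : EReal) < c → Z t = v t := by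
    intro a' v ha' hv hvz t ht1 ht2
    have htS : sInf S < t := (sInf_le (show a' ∈ S from ⟨ha', v, hv, hvz⟩)).trans_lt ht1
    obtain ⟨h1, h2, h3, h4⟩ := hαw t htS
    have hlt : max (α t) a' < (c : EReal) := max_lt h3.1 hv.1
    refine (h3.mono (le_max_left _ _) le_rfl hlt).eq_of_eq hf (hv.mono (le_max_right _ _) le_rfl hlt)
      (t₀ := t₀) ((max_le h2 ha').trans_lt h₁) h₂ ?_ t (max_lt h1 ht1) ht2
    rw [h4 t₀ h₁ h₂, hvz t₀ h₁ h₂]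
  have hZz : ∀ t : ℝ, a < t → (t : EReal) < c → Z t = z t := hZ a z le_rfl hz fun _ _ _ => rfl
  have hZlim : Tendsto Z (𝓝[<] c) (Bornology.cobounded ℂ) := by
    refine hlim.congr' ?_
    have hac := (continuous_coe_real_ereal.continuousAt (x := c)).eventually_const_lt hz.1
    filter_upwards [nhdsWithin_le_nhds hac, self_mem_nhdsWithin] with t h1 h2
    exact (hZz t h1 (EReal.coe_lt_coe_iff.2 h2)).symm
  have hZsol : FlowSol f (sInf S) c Z := by
    refine ⟨hAa.trans_lt hz.1, fun t ht1 ht2 => ?_⟩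
    obtain ⟨h1, h2, h3, h4⟩ := hαw t ht1
    exact (h3.congr (hZ _ _ h2 h3 h4)).2 t h1 ht2
  refine ⟨sInf S, Z, ⟨⟨hZsol, ?_⟩, c, rfl, hZlim⟩, fun t h1 h2 => hZz t h1 (by exact_mod_cast h2)⟩
  intro a' b' v hv ha' hb' hvZ
  have hb : b' = c := by
    refine hb'.antisymm' (not_lt.1 fun hlt => ?_)
    refine (hv.2 c (ha'.trans_lt hZsol.1) hlt).continuousAt.not_tendsto_cobounded_nhdsLT
      (hZlim.congr' ?_)
    have hac := (continuous_coe_real_ereal.continuousAt (x := c)).eventually_const_lt hZsol.1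
    filter_upwards [nhdsWithin_le_nhds hac, self_mem_nhdsWithin] with t h1 h2
    exact (hvZ t h1 (EReal.coe_lt_coe_iff.2 h2)).symm
  refine ⟨ha'.antisymm (sInf_le ⟨ha'.trans hAa, v, hb ▸ hv, fun t h1 h2 => ?_⟩), hb⟩
  rw [hvZ t (hAa.trans_lt h1) h2, hZz t h1 h2]

/-- If the trajectories of two solutions that blow up at the same time `c` meet, the solutions
coincide shortly before `c`. -/
theorem FlowSol.eventuallyEq_of_not_disjoint {f : ℂ → ℂ} (hf : ContDiff ℂ 1 f) {a b : EReal} {c : ℝ}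
    {z w : ℝ → ℂ} (hz : FlowSol f a c z) (hw : FlowSol f b c w)
    (hzlim : Tendsto z (𝓝[<] c) (Bornology.cobounded ℂ))
    (hwlim : Tendsto w (𝓝[<] c) (Bornology.cobounded ℂ))
    (h : ¬ Disjoint (Traj a c z) (Traj b c w)) : z =ᶠ[𝓝[<] c] w := by
  obtain ⟨_, ⟨t₁, ⟨h1, h2⟩, rfl⟩, t₂, ⟨h3, h4⟩, heq⟩ := Set.not_disjoint_iff.1 h
  wlog hle : t₁ ≤ t₂ generalizing a b z w t₁ t₂
  · exact (this hw hz hwlim hzlim (fun hd => h hd.symm) t₂ h3 h4 t₁ heq.symm h1 h2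
      (le_of_not_ge hle)).symm
  have h4' : t₂ < c := by exact_mod_cast h4
  obtain ⟨r₁, h5, h6⟩ := EReal.lt_iff_exists_real_btwn.1 h1
  obtain ⟨r₂, h7, h8⟩ := EReal.lt_iff_exists_real_btwn.1 h3
  have h6' : r₁ < t₁ := by exact_mod_cast h6
  have h8' : r₂ < t₂ := by exact_mod_cast h8
  have key : ∀ s : ℝ, max r₂ (r₁ + (t₂ - t₁)) < s → s < c → w s = z (s + (t₁ - t₂)) := by
    intro s hs1 hs2
    have hm : max r₂ (r₁ + (t₂ - t₁)) < t₂ := max_lt h8' (by linarith)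
    have hmc : ((max r₂ (r₁ + (t₂ - t₁)) : ℝ) : EReal) < c := by exact_mod_cast hm.trans h4'
    have hw' : FlowSol f (max r₂ (r₁ + (t₂ - t₁)) : ℝ) c w :=
      hw.mono (h7.le.trans (by exact_mod_cast le_max_left _ _)) le_rfl hmc
    have hz' : FlowSol f (max r₂ (r₁ + (t₂ - t₁)) : ℝ) c fun s => z (s + (t₁ - t₂)) := by
      refine ⟨hmc, fun t ht1 ht2 => (hz.2 _ ?_ ?_).comp_add_const t (t₁ - t₂)⟩
      · refine h5.trans ?_
        have := (le_max_right r₂ _).trans_lt (EReal.coe_lt_coe_iff.1 ht1)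
        exact_mod_cast (by linarith : r₁ < t + (t₁ - t₂))
      · have := EReal.coe_lt_coe_iff.1 ht2
        exact_mod_cast (by linarith : t + (t₁ - t₂) < c)
    exact hw'.eq_of_eq hf hz' (t₀ := t₂) (by exact_mod_cast hm) h4 (by simpa using heq) s
      (by exact_mod_cast hs1) (by exact_mod_cast hs2)
  have hev : ∀ᶠ s in 𝓝[<] c, w s = z (s + (t₁ - t₂)) := by
    filter_upwards [Ioo_mem_nhdsLT (max_lt (h8'.trans h4') (by linarith :
      r₁ + (t₂ - t₁) < c))] with s hs using key s hs.1 hs.2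
  obtain hlt | rfl := hle.lt_or_eq
  · exfalso
    have hd : HasDerivAt (fun s => z (s + (t₁ - t₂))) (f (z (c + (t₁ - t₂)))) c := by
      refine (hz.2 _ (h1.trans ?_) ?_).comp_add_const c (t₁ - t₂)
      · exact_mod_cast (by linarith : t₁ < c + (t₁ - t₂))
      · exact_mod_cast (by linarith : c + (t₁ - t₂) < c)
    exact hd.continuousAt.not_tendsto_cobounded_nhdsLT (hwlim.congr' hev)
  · filter_upwards [hev] with s hs
    simpa using hs.symm

/-- An analytic function not vanishing at a point has an analytic `d`-th root near that point. -/
theorem AnalyticAt.exists_pow_eq {h : ℂ → ℂ} {a : ℂ} (hh : AnalyticAt ℂ h a) (h0 : h a ≠ 0)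
    {d : ℕ} (hd : d ≠ 0) :
    ∃ r : ℂ → ℂ, AnalyticAt ℂ r a ∧ r a ≠ 0 ∧ ∀ᶠ u in 𝓝 a, r u ^ d = h u := by
  obtain ⟨c, hc⟩ := IsAlgClosed.exists_pow_nat_eq (h a) (Nat.pos_of_ne_zero hd)
  have hc0 : c ≠ 0 := by
    rintro rfl
    rw [zero_pow hd] at hc
    exact h0 hc.symm
  refine ⟨fun u => Complex.exp (Complex.log (h u / h a) / d) * c, ?_, ?_, ?_⟩
  · have : AnalyticAt ℂ (fun u => Complex.log (h u / h a)) a :=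
      (hh.div analyticAt_const h0).clog (by simp [div_self h0])
    fun_prop
  · simp [hc0]
  · filter_upwards [hh.continuousAt.eventually_ne h0] with u hu
    have hd' : (d : ℂ) ≠ 0 := by exact_mod_cast hd
    rw [mul_pow, hc, ← Complex.exp_nat_mul, mul_div_cancel₀ _ hd',
      Complex.exp_log (div_ne_zero hu h0), div_mul_cancel₀ _ h0]

/-- If the derivative of `H` is `u ^ m * k u` with `k 0 ≠ 0` and `H 0 = 0`, then `H` becomes
`y ^ (m + 1)` in a suitable local holomorphic coordinate `y` at the origin. -/
theorem exists_local_coordinate {k : ℂ → ℂ} (hk : AnalyticAt ℂ k 0) (hk0 : k 0 ≠ 0) (m : ℕ) :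
    ∃ ψ φ H : ℂ → ℂ, ψ 0 = 0 ∧ ∀ᶠ y in 𝓝 (0 : ℂ), DifferentiableAt ℂ ψ y ∧ φ (ψ y) = y ∧
      HasDerivAt H (ψ y ^ m * k (ψ y)) (ψ y) ∧ H (ψ y) = y ^ (m + 1) := by
  have hκ : AnalyticAt ℂ (fun u => u ^ m * k u) 0 := by fun_prop
  obtain ⟨ρ, hρ, hball⟩ := Metric.eventually_nhds_iff_ball.1 hκ.eventually_analyticAt
  obtain ⟨H, hH0, hH⟩ := (DifferentiableOn.isExactOn_ball (c := 0) (r := ρ)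
    fun u hu => (hball u hu).differentiableAt.differentiableWithinAt).with_val_at 0 0
  have hHev : ∀ᶠ u in 𝓝 (0 : ℂ), HasDerivAt H (u ^ m * k u) u :=
    Metric.eventually_nhds_iff_ball.2 ⟨ρ, hρ, hH⟩
  have hHan : AnalyticAt ℂ H 0 :=
    Complex.analyticAt_iff_eventually_differentiableAt.2 (hHev.mono fun u hu => hu.differentiableAt)
  have hord : analyticOrderAt H 0 = ((m + 1 : ℕ) : ℕ∞) := by
    have h1 := hHan.analyticOrderAt_deriv_add_one
    have h2 : analyticOrderAt (deriv H) 0 = m := by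
      rw [hHan.deriv.analyticOrderAt_eq_natCast]
      exact ⟨k, hk, hk0, hHev.mono fun u hu => by simp [hu.deriv]⟩
    simp only [hH0, sub_zero, h2] at h1
    rw [← h1]; simp
  obtain ⟨h, hh, hh0, hHh⟩ := hHan.analyticOrderAt_eq_natCast.1 hord
  obtain ⟨r, hr, hr0, hrh⟩ := hh.exists_pow_eq hh0 m.succ_ne_zero
  have hφan : AnalyticAt ℂ (fun u => u * r u) 0 := by fun_prop
  have hφ' : HasDerivAt (fun u => u * r u) (r 0) 0 :=
    ((hasDerivAt_id (0 : ℂ)).mul hr.differentiableAt.hasDerivAt).congr_deriv (by simp)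
  have hs : HasStrictDerivAt (fun u => u * r u) (r 0) 0 := by
    have := hφan.hasStrictDerivAt
    rwa [hφ'.deriv] at this
  have hsF := hs.hasStrictFDerivAt_equiv hr0
  have hcd : ContDiffAt ℂ 1 (fun u => u * r u) 0 := hφan.contDiffAt
  set ψ := hcd.localInverse hsF.hasFDerivAt one_ne_zero with hψ
  have hψ0 : ψ 0 = 0 := by simpa using hcd.localInverse_apply_image hsF.hasFDerivAt one_ne_zero
  have hψc : ContDiffAt ℂ 1 ψ 0 := by
    simpa using hcd.to_localInverse hsF.hasFDerivAt one_ne_zero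
  have hψt : Tendsto ψ (𝓝 0) (𝓝 0) := by simpa [ContinuousAt, hψ0] using hψc.continuousAt
  have hinv : ∀ᶠ y in 𝓝 (0 : ℂ), ψ y * r (ψ y) = y := by
    have := hsF.eventually_right_inverse
    simp only [zero_mul] at this
    exact this
  refine ⟨ψ, fun u => u * r u, H, hψ0, ?_⟩
  filter_upwards [hψc.eventually (by simp), hinv, hψt.eventually hHev, hψt.eventually hHh,
    hψt.eventually hrh] with y h1 h2 h3 h4 h5
  refine ⟨h1.differentiableAt one_ne_zero, h2, h3, ?_⟩
  rw [h4, ← h5, sub_zero, smul_eq_mul, ← mul_pow, h2]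

theorem Polynomial.eval_inv_eq_eval_reverse_mul {K : Type*} [Field K] (f : Polynomial K) {u : K}
    (hu : u ≠ 0) : f.eval u⁻¹ = f.reverse.eval u * u⁻¹ ^ f.natDegree := by
  let := invertibleOfNonzero (inv_ne_zero hu)
  have h := Polynomial.eval₂_reverse_mul_pow (RingHom.id K) u⁻¹ f
  rw [invOf_eq_inv, inv_inv] at h
  exact h.symm

/-- Near infinity, `ż = f(z)` has `deg f - 1` distinct solutions blowing up at time `0`. -/
theorem Polynomial.exists_local_escaping_solutions (f : Polynomial ℂ) (hdeg : 2 ≤ f.natDegree) :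
    ∃ (ε : ℝ) (z : Fin (f.natDegree - 1) → ℝ → ℂ), 0 < ε ∧
      (∀ i, ∀ t ∈ Ioo (-ε) 0, HasDerivAt (z i) (f.eval (z i t)) t) ∧
      (∀ i, Tendsto (z i) (𝓝[<] 0) (Bornology.cobounded ℂ)) ∧
      ∀ i j, i ≠ j → ∀ t ∈ Ioo (-ε) 0, z i t ≠ z j t := by
  obtain ⟨m, hm⟩ : ∃ m, f.natDegree = m + 2 := ⟨f.natDegree - 2, by omega⟩
  obtain ⟨d, hd⟩ : ∃ d, d = m + 1 := ⟨_, rfl⟩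
  rw [show f.natDegree - 1 = d by omega]
  have hd0 : d ≠ 0 := by omega
  have hg0 : f.reverse.eval 0 ≠ 0 := by
    rw [← Polynomial.coeff_zero_eq_eval_zero, Polynomial.coeff_zero_reverse, ne_eq,
      Polynomial.leadingCoeff_eq_zero]
    rintro rfl
    simp at hm
  have hgan : AnalyticAt ℂ (fun u => f.reverse.eval u) 0 := by
    simpa using AnalyticAt.aeval_polynomial (analyticAt_id (𝕜 := ℂ) (z := (0 : ℂ))) f.reverse
  obtain ⟨ψ, φ, H, hψ0, hψ⟩ := exists_local_coordinate (hgan.inv hg0) (inv_ne_zero hg0) m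
  have hφ0 : φ 0 = 0 := by simpa [hψ0] using hψ.self_of_nhds.2.1
  have hψt : Tendsto ψ (𝓝 0) (𝓝 0) := by
    simpa [ContinuousAt, hψ0] using hψ.self_of_nhds.1.continuousAt
  have hgψ : ∀ᶠ y in 𝓝 (0 : ℂ), f.reverse.eval (ψ y) ≠ 0 :=
    hψt.eventually (hgan.continuousAt.eventually_ne hg0)
  set ω := Complex.exp (2 * Real.pi * Complex.I / d)
  have hω : IsPrimitiveRoot ω d := Complex.isPrimitiveRoot_exp d hd0
  set s : ℝ → ℝ := fun t => (-t) ^ (d⁻¹ : ℝ) with hs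
  have hspow : ∀ t < 0, s t ^ d = -t := fun t ht => Real.rpow_inv_natCast_pow (by linarith) hd0
  have hs0 : ∀ t < 0, s t ≠ 0 := fun t ht h => by
    have := hspow t ht
    rw [h, zero_pow hd0] at this
    linarith
  have hsd : ∀ t < 0, DifferentiableAt ℝ s t := fun t ht =>
    (differentiableAt_id.neg).rpow_const (Or.inl (by simpa using ht.ne))
  have hst : Tendsto s (𝓝[<] 0) (𝓝 0) := by
    have : ContinuousAt s 0 :=
      continuousAt_neg.rpow_const (Or.inr (by positivity))
    have h := this.tendsto
    rw [show s 0 = 0 by simp [hs, hd0]] at h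
    exact h.mono_left nhdsWithin_le_nhds
  set y : Fin d → ℝ → ℂ := fun i t => ω ^ (i : ℕ) * s t with hy
  have hyt : ∀ i, Tendsto (y i) (𝓝[<] 0) (𝓝 0) := fun i => by
    simpa using ((Complex.continuous_ofReal.tendsto 0).comp hst).const_mul (ω ^ (i : ℕ))
  have hypow : ∀ i, ∀ t < 0, y i t ^ d = -t := fun i t ht => by
    rw [hy]
    simp only
    rw [mul_pow, ← pow_mul, mul_comm (i : ℕ) d, pow_mul, hω.pow_eq_one, one_pow, one_mul,
      ← Complex.ofReal_pow, hspow t ht, Complex.ofReal_neg]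
  have hy0 : ∀ i, ∀ t < 0, y i t ≠ 0 := fun i t ht =>
    mul_ne_zero (pow_ne_zero _ (hω.ne_zero hd0)) (by exact_mod_cast hs0 t ht)
  have hyd : ∀ i, ∀ t < 0, DifferentiableAt ℝ (y i) t := fun i t ht =>
    ((hsd t ht).hasDerivAt.ofReal_comp.const_mul _).differentiableAt
  have hev : ∀ᶠ t in 𝓝[<] (0 : ℝ), ∀ i, (DifferentiableAt ℂ ψ (y i t) ∧ φ (ψ (y i t)) = y i t ∧
      HasDerivAt H (ψ (y i t) ^ m * (f.reverse.eval (ψ (y i t)))⁻¹) (ψ (y i t)) ∧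
      H (ψ (y i t)) = y i t ^ (m + 1)) ∧ f.reverse.eval (ψ (y i t)) ≠ 0 :=
    eventually_all.2 fun i => (hyt i).eventually (hψ.and hgψ)
  obtain ⟨a, ha, hev⟩ := (mem_nhdsLT_iff_exists_Ioo_subset).1 hev
  have hψne : ∀ i, ∀ t ∈ Ioo a 0, ψ (y i t) ≠ 0 := fun i t ht h => by
    have := (hev ht i).1.2.1
    rw [h, hφ0] at this
    exact hy0 i t ht.2 this.symm
  refine ⟨-a, fun i t => (ψ (y i t))⁻¹, by simpa using ha, ?_, ?_, ?_⟩
  · rw [neg_neg]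
    intro i t ht
    obtain ⟨⟨h1, h2, h3, h4⟩, h5⟩ := hev ht i
    have hne := hψne i t ht
    have hu : HasDerivAt (fun t => ψ (y i t)) (deriv ψ (y i t) * deriv (y i) t) t :=
      h1.hasDerivAt.comp t (hyd i t ht.2).hasDerivAt
    set u' := deriv ψ (y i t) * deriv (y i) t
    have hHu : HasDerivAt (fun t => H (ψ (y i t)))
        (ψ (y i t) ^ m * (f.reverse.eval (ψ (y i t)))⁻¹ * u') t := h3.comp t hu
    have hHu' : HasDerivAt (fun t => H (ψ (y i t))) (-1) t := by
      refine ((hasDerivAt_id t).ofReal_comp.neg.congr_deriv (by simp)).congr_of_eventuallyEq ?_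
      filter_upwards [Ioo_mem_nhds ht.1 ht.2] with τ hτ
      rw [(hev hτ i).1.2.2.2, ← hd, hypow i τ hτ.2]
      simp
    have hkey := hHu.unique hHu'
    refine (hu.inv hne).congr_deriv ?_
    rw [f.eval_inv_eq_eval_reverse_mul hne, hm, inv_pow]
    field_simp at hkey ⊢
    linear_combination -ψ (y i t) ^ 2 * hkey
  · intro i
    refine tendsto_inv₀_nhdsNE_zero.comp (tendsto_nhdsWithin_iff.2 ⟨hψt.comp (hyt i), ?_⟩)
    filter_upwards [Ioo_mem_nhdsLT ha] with t ht using hψne i t ht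
  · rw [neg_neg]
    intro i j hij t ht h
    have h' := congrArg φ (inv_injective h)
    rw [(hev ht i).1.2.1, (hev ht j).1.2.1] at h'
    refine hij (Fin.ext (hω.pow_inj i.2 j.2 (mul_right_cancel₀ ?_ h')))
    exact_mod_cast hs0 t ht.2

/-- Theorem ([kingneedham, Theorem 5]): for a polynomial `f` of degree `n ≥ 2`, the
holomorphic flow `ż = f(z)` has `n - 1` pairwise disjoint trajectories which tend to
infinity in finite increasing time. -/
theorem polynomial_flow_escaping_trajectories
    (f : Polynomial ℂ) (hdeg : 2 ≤ f.natDegree) :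
    ∃ (Z : Fin (f.natDegree - 1) → ℝ → ℂ) (A B : Fin (f.natDegree - 1) → EReal),
      (∀ i, EscapesInFiniteTime (fun w => f.eval w) (A i) (B i) (Z i)) ∧
      Pairwise fun i j =>
        Disjoint (Traj (A i) (B i) (Z i)) (Traj (A j) (B j) (Z j)) := by
  have hf : ContDiff ℂ 1 (fun w => f.eval w) := f.differentiable.contDiff
  obtain ⟨ε, z, hε, hz, hlim, hne⟩ := f.exists_local_escaping_solutions hdeg
  have hsol : ∀ i, FlowSol (fun w => f.eval w) (-ε : ℝ) (0 : ℝ) (z i) := fun i =>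
    ⟨by exact_mod_cast neg_lt_zero.2 hε, fun t h1 h2 =>
      hz i t ⟨EReal.coe_lt_coe_iff.1 h1, EReal.coe_lt_coe_iff.1 h2⟩⟩
  choose A Z hZ hZz using fun i => (hsol i).exists_escapesInFiniteTime hf (hlim i)
  refine ⟨Z, A, fun _ => (0 : ℝ), hZ, fun i j hij => ?_⟩
  by_contra hd
  have hZlim : ∀ i, Tendsto (Z i) (𝓝[<] 0) (Bornology.cobounded ℂ) := fun i => by
    obtain ⟨c, hc, h⟩ := (hZ i).2
    rwa [← EReal.coe_injective hc] at h
  have heq := (hZ i).1.1.eventuallyEq_of_not_disjoint hf (hZ j).1.1 (hZlim i) (hZlim j) hd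
  obtain ⟨t, h1, h2⟩ := (heq.and (Ioo_mem_nhdsLT (neg_lt_zero.2 hε))).exists
  refine hne i j hij t h2 ?_
  have h3 : ((-ε : ℝ) : EReal) < t := by exact_mod_cast h2.1
  rw [← hZz i t h3 h2.2, ← hZz j t h3 h2.2, h1]
end
end

section
/- Consider the holomorphic flow ż = −exp(−z). Every trajectory z : (α, β) → ℂ of this flow satisfies exp(z(t)) = exp(z(0)) − t for all t, every trajectory tends to infinity as t increases, and the trajectory tends to infinity in finite increasing time (i.e. β < +∞) if and only if exp(z(0)) is real and positive, in which case β = exp(z(0)). -/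
open Filter Set

noncomputable section

theorem FlowSol.exp_add_eq {a b : EReal} {z : ℝ → ℂ}
    (hz : FlowSol (fun w => -Complex.exp (-w)) a b z) {s t : ℝ}
    (hs : a < (s : EReal) ∧ (s : EReal) < b) (ht : a < (t : EReal) ∧ (t : EReal) < b) :
    Complex.exp (z t) + t = Complex.exp (z s) + s := by
  have hd : ∀ u ∈ (fun u : ℝ => (u : EReal)) ⁻¹' Ioo a b,
      HasDerivAt (fun u : ℝ => Complex.exp (z u) + u) 0 u := by
    intro u hu
    have h := (hz.2 u hu.1 hu.2).cexp.add (Complex.ofRealCLM.hasDerivAt (x := u))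
    refine h.congr_deriv ?_
    simp [← Complex.exp_add]
  have hconn : ((fun u : ℝ => (u : EReal)) ⁻¹' Ioo a b).OrdConnected :=
    ordConnected_Ioo.preimage_mono EReal.coe_strictMono.monotone
  exact (isOpen_Ioo.preimage continuous_coe_real_ereal).is_const_of_deriv_eq_zero
    hconn.isPreconnected (fun u hu => (hd u hu).differentiableAt.differentiableWithinAt)
    (fun u hu => (hd u hu).deriv) ht hs

/-- A solution on `(a, c)` of `ż = -exp(-z)` whose exponential `E - t` does not vanish at the
finite endpoint `c` extends beyond `c`. -/
theorem FlowSol.exists_extension {a : EReal} {c : ℝ} {z : ℝ → ℂ} {E : ℂ}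
    (hz : FlowSol (fun w => -Complex.exp (-w)) a c z)
    (hexp : ∀ t : ℝ, a < (t : EReal) → (t : EReal) < c → Complex.exp (z t) = E - t)
    (hE : E ≠ c) :
    ∃ d : ℝ, c < d ∧ ∃ w : ℝ → ℂ, FlowSol (fun w => -Complex.exp (-w)) a d w ∧
      ∀ t : ℝ, t < c → w t = z t := by
  have hEc : E - c ≠ 0 := sub_ne_zero.2 hE
  have hev : ∀ᶠ t : ℝ in nhds c, a < (t : EReal) ∧ (E - t) / (E - c) ∈ Complex.slitPlane := by
    refine (continuous_coe_real_ereal.continuousAt.eventually (lt_mem_nhds hz.1)).and ?_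
    have hcont : ContinuousAt (fun t : ℝ => (E - t) / (E - c)) c := by fun_prop
    refine hcont.eventually (Complex.isOpen_slitPlane.mem_nhds ?_)
    simp [div_self hEc]
  obtain ⟨δ, hδ, hball⟩ := Metric.eventually_nhds_iff.1 hev
  have hnear : ∀ t ∈ Ioo (c - δ) (c + δ),
      a < (t : EReal) ∧ (E - t) / (E - c) ∈ Complex.slitPlane := fun t ht =>
    hball (by rw [Real.dist_eq, abs_lt]; constructor <;> linarith [ht.1, ht.2])
  have hne : ∀ t ∈ Ioo (c - δ) (c + δ), E - t ≠ 0 := fun t ht h => by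
    have := Complex.slitPlane_ne_zero (hnear t ht).2
    simp [h] at this
  set g : ℝ → ℂ := fun t => Complex.log ((E - t) / (E - c))
  have hgd : ∀ t ∈ Ioo (c - δ) (c + δ), HasDerivAt g (-(E - t)⁻¹) t := by
    intro t ht
    have h := (((Complex.ofRealCLM.hasDerivAt (x := t)).const_sub E).div_const
      (E - c)).clog_real (hnear t ht).2
    refine h.congr_deriv ?_
    have := hne t ht
    simp
    field_simp
  have hzd : ∀ t ∈ Ioo (c - δ) c, HasDerivAt z (-(E - t)⁻¹) t := by
    intro t ht
    have hat := (hnear t ⟨ht.1, by linarith [ht.2]⟩).1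
    have htc : (t : EReal) < c := EReal.coe_lt_coe_iff.2 ht.2
    simpa [Complex.exp_neg, hexp t hat htc] using hz.2 t hat htc
  have hsub : ∀ t ∈ Ioo (c - δ) c, t ∈ Ioo (c - δ) (c + δ) := fun t ht =>
    ⟨ht.1, by linarith [ht.2]⟩
  have hmid : c - δ / 2 ∈ Ioo (c - δ) c := ⟨by linarith, by linarith⟩
  set K : ℂ := z (c - δ / 2) - g (c - δ / 2) with hK
  have hzg : ∀ t ∈ Ioo (c - δ) c, z t = K + g t := by
    intro t ht
    have hd : ∀ u ∈ Ioo (c - δ) c, HasDerivAt (fun u => z u - g u) 0 u := fun u hu =>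
      ((hzd u hu).sub (hgd u (hsub u hu))).congr_deriv (sub_self _)
    have := isOpen_Ioo.is_const_of_deriv_eq_zero isPreconnected_Ioo
      (fun u hu => (hd u hu).differentiableAt.differentiableWithinAt)
      (fun u hu => (hd u hu).deriv) ht hmid
    rw [hK, ← this]
    ring
  have hexpg : ∀ t ∈ Ioo (c - δ) (c + δ), Complex.exp (g t) = (E - t) / (E - c) := fun t ht =>
    Complex.exp_log (div_ne_zero (hne t ht) hEc)
  have hexpK : Complex.exp K = E - c := by
    have hm := hsub _ hmid
    rw [hK, Complex.exp_sub, hexpg _ hm,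
      hexp _ (hnear _ hm).1 (EReal.coe_lt_coe_iff.2 hmid.2)]
    exact div_div_cancel₀ (hne _ hm)
  refine ⟨c + δ, by linarith, fun t => if t < c then z t else K + g t, ⟨?_, ?_⟩,
    fun t ht => if_pos ht⟩
  · exact hz.1.trans (EReal.coe_lt_coe_iff.2 (by linarith))
  · intro t hat htd
    have htd' : t < c + δ := EReal.coe_lt_coe_iff.1 htd
    rcases lt_or_ge t c with htc | htc
    · simp only [if_pos htc]
      refine (hz.2 t hat (EReal.coe_lt_coe_iff.2 htc)).congr_of_eventuallyEq ?_
      filter_upwards [Iio_mem_nhds htc] with u hu using if_pos hu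
    · have ht : t ∈ Ioo (c - δ) (c + δ) := ⟨by linarith, htd'⟩
      simp only [if_neg htc.not_gt]
      have h : HasDerivAt (fun u => K + g u) (-Complex.exp (-(K + g t))) t := by
        refine ((hgd t ht).const_add K).congr_deriv ?_
        rw [Complex.exp_neg, Complex.exp_add, hexpK, hexpg t ht, mul_div_cancel₀ _ hEc]
      refine h.congr_of_eventuallyEq ?_
      filter_upwards [isOpen_Ioo.mem_nhds ht] with u hu
      split_ifs with huc
      · exact hzg u ⟨hu.1, huc⟩
      · rfl

theorem MaxFlowSol.exp_endpoint_eq {a : EReal} {c : ℝ} {z : ℝ → ℂ} {E : ℂ}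
    (hz : MaxFlowSol (fun w => -Complex.exp (-w)) a c z)
    (hexp : ∀ t : ℝ, a < (t : EReal) → (t : EReal) < c → Complex.exp (z t) = E - t) :
    E = c := by
  by_contra hE
  obtain ⟨d, hcd, w, hw, hwz⟩ := hz.1.exists_extension hexp hE
  have h := (hz.2 a d w hw le_rfl (EReal.coe_le_coe_iff.2 hcd.le)
    fun t _ ht => hwz t (EReal.coe_lt_coe_iff.1 ht)).2
  exact hcd.ne' (EReal.coe_injective h)

theorem tendsto_cobounded_of_tendsto_abs_log_norm_exp {α : Type*} {l : Filter α} {z : α → ℂ}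
    (h : Tendsto (fun t => |Real.log ‖Complex.exp (z t)‖|) l atTop) :
    Tendsto z l (Bornology.cobounded ℂ) := by
  rw [← tendsto_norm_atTop_iff_cobounded]
  refine tendsto_atTop_mono (fun t => ?_) h
  rw [Complex.norm_exp, Real.log_exp]
  exact Complex.abs_re_le_norm _

/-- For the flow `ż = -exp(-z)`: every maximal trajectory defined at `t = 0` satisfies
`exp (z t) = exp (z 0) - t`, tends to infinity as `t` increases to `b`, and reaches infinity
in finite time (`b < +∞`) iff `exp (z 0)` is real and positive, in which case
`b = exp (z 0)`. -/
theorem exp_flow_trajectories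
    (a b : EReal) (z : ℝ → ℂ)
    (hz : MaxFlowSol (fun w => -Complex.exp (-w)) a b z)
    (ha : a < (0 : EReal)) (hb : (0 : EReal) < b) :
    (∀ t : ℝ, a < (t : EReal) → (t : EReal) < b →
      Complex.exp (z t) = Complex.exp (z 0) - t) ∧
    Tendsto z (Filter.comap (fun t : ℝ => (t : EReal)) (nhdsWithin b (Set.Iio b)))
      (Bornology.cobounded ℂ) ∧
    (b ≠ ⊤ ↔ (Complex.exp (z 0)).im = 0 ∧ 0 < (Complex.exp (z 0)).re) ∧
    ((Complex.exp (z 0)).im = 0 ∧ 0 < (Complex.exp (z 0)).re →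
      b = ((Complex.exp (z 0)).re : EReal)) := by
  have hexp : ∀ t : ℝ, a < (t : EReal) → (t : EReal) < b →
      Complex.exp (z t) = Complex.exp (z 0) - t := fun t hat htb => by
    have := hz.1.exp_add_eq (s := 0) ⟨ha, hb⟩ ⟨hat, htb⟩
    rw [eq_sub_iff_add_eq, this]
    simp
  have hfin : ∀ c : ℝ, b = c → Complex.exp (z 0) = c := by
    rintro c rfl
    exact hz.exp_endpoint_eq hexp
  have hcoe : b ≠ ⊤ → ∃ c : ℝ, b = c := fun h =>
    ⟨b.toReal, (EReal.coe_toReal h (bot_lt_iff_ne_bot.1 (bot_le.trans_lt hb))).symm⟩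
  have hpos : (Complex.exp (z 0)).im = 0 ∧ 0 < (Complex.exp (z 0)).re → b ≠ ⊤ := by
    rintro ⟨him, hre⟩ rfl
    refine Complex.exp_ne_zero (z (Complex.exp (z 0)).re) ?_
    rw [hexp _ (ha.trans (EReal.coe_pos.2 hre)) (EReal.coe_lt_top _)]
    apply Complex.ext <;> simp [him]
  refine ⟨hexp, ?_, ⟨fun h => ?_, hpos⟩, fun h => ?_⟩
  · apply tendsto_cobounded_of_tendsto_abs_log_norm_exp
    have hev : ∀ᶠ t : ℝ in comap (fun t : ℝ => (t : EReal)) (nhdsWithin b (Iio b)),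
        |Real.log ‖Complex.exp (z 0) - t‖| = |Real.log ‖Complex.exp (z t)‖| := by
      have hab : ∀ᶠ x in nhdsWithin b (Iio b), a < x ∧ x < b :=
        Filter.Eventually.and (nhdsWithin_le_nhds (lt_mem_nhds hz.1.1)) self_mem_nhdsWithin
      filter_upwards [hab.comap _] with t ht
      rw [hexp t ht.1 ht.2]
    refine Tendsto.congr' hev ?_
    by_cases hbt : b = ⊤
    · subst hbt
      have hle : comap (fun t : ℝ => (t : EReal)) (nhdsWithin ⊤ (Iio ⊤)) ≤ atTop := by
        rw [← tendsto_id', tendsto_atTop]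
        intro M
        have : ∀ᶠ x in nhdsWithin (⊤ : EReal) (Iio ⊤), (M : EReal) < x :=
          nhdsWithin_le_nhds (lt_mem_nhds (EReal.coe_lt_top M))
        filter_upwards [this.comap _] with t ht using (EReal.coe_lt_coe_iff.1 ht).le
      refine Tendsto.mono_left ?_ hle
      refine tendsto_abs_atTop_atTop.comp (Real.tendsto_log_atTop.comp ?_)
      refine tendsto_atTop_mono (fun t => ?_)
        (tendsto_atTop_add_const_right _ (-(Complex.exp (z 0)).re) tendsto_id)
      have := (neg_le_abs _).trans (Complex.abs_re_le_norm (Complex.exp (z 0) - t))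
      simp only [Complex.sub_re, Complex.ofReal_re] at this
      simp only [id]
      linarith
    · obtain ⟨c, rfl⟩ := hcoe hbt
      refine tendsto_abs_atBot_atTop.comp (Real.tendsto_log_nhdsNE_zero.comp ?_)
      rw [hfin c rfl]
      refine tendsto_nhdsWithin_iff.2 ⟨?_, ?_⟩
      · have hle : comap (fun t : ℝ => (t : EReal)) (nhdsWithin (c : EReal) (Iio (c : EReal))) ≤
            nhds c := by
          rw [EReal.isEmbedding_coe.nhds_eq_comap]
          exact comap_mono nhdsWithin_le_nhds
        have hcont : ContinuousAt (fun t : ℝ => ‖(c : ℂ) - t‖) c := by fun_prop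
        simpa [ContinuousAt] using hcont.tendsto.mono_left hle
      · have hlt : ∀ᶠ x in nhdsWithin (c : EReal) (Iio (c : EReal)), x < (c : EReal) := self_mem_nhdsWithin
        filter_upwards [hlt.comap _] with t ht
        have := (EReal.coe_lt_coe_iff.1 ht).ne'
        simpa [sub_eq_zero] using this
  · obtain ⟨c, rfl⟩ := hcoe h
    rw [hfin c rfl]
    exact ⟨Complex.ofReal_im c, by simpa using hb⟩
  · obtain ⟨c, rfl⟩ := hcoe (hpos h)
    rw [hfin c rfl, Complex.ofReal_re]
end
end

section
/- There exists a transcendental entire function f such that the holomorphic flow ż = f(z) has uncountably many pairwise disjoint trajectories tending to infinity in finite increasing time. -/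
open Filter Set

noncomputable section

open Complex Topology MeasureTheory

/-- The region swept out by nested vertical windows: the window `[lo m, hi m]` constrains the
points to the right of the line `re = m`, and `[lo 0, hi 0]` constrains all points. -/
def tube (lo hi : ℕ → ℝ) : Set ℂ :=
  {z | z.im ∈ Icc (lo 0) (hi 0) ∧ ∀ m : ℕ, (m : ℝ) < z.re → z.im ∈ Icc (lo m) (hi m)}

/-- The time function of the flow `ż = f(z)`: the integral of `1 / f` along the vertical segment
from `0` to `z.im * I` followed by the horizontal segment ending at `z`. -/
def flowTime (f : ℂ → ℂ) (z : ℂ) : ℂ :=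
  (∫ s in (0 : ℝ)..z.re, (f (s + z.im * I))⁻¹) + I * ∫ τ in (0 : ℝ)..z.im, (f (τ * I))⁻¹

/-- Conditions under which a trajectory of `ż = f(z)` stays in `tube lo hi` forever: the field
points to the right inside a cone, and points out of the tube on its horizontal sides. -/
structure IsFunnel (f : ℂ → ℂ) (lo hi : ℕ → ℝ) (c : ℝ) : Prop where
  diff : Differentiable ℂ f
  lo_mono : Monotone lo
  hi_anti : Antitone hi
  lo_lt_hi : ∀ n, lo n < hi n
  zero_mem : (0 : ℝ) ∈ Icc (lo 0) (hi 0)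
  c_pos : 0 < c
  le_re : ∀ z ∈ tube lo hi, c * Real.exp z.re ≤ (f z).re
  im_le : ∀ z ∈ tube lo hi, |(f z).im| ≤ (f z).re / 2
  norm_le : ∀ z ∈ tube lo hi, z.re ≤ 0 → ‖f z‖ ≤ 2
  hi_side : ∀ (n : ℕ) (x : ℝ), (n = 0 ∨ (n : ℝ) ≤ x) → x ≤ n + 1 → 0 < (f (x + hi n * I)).im
  lo_side : ∀ (n : ℕ) (x : ℝ), (n = 0 ∨ (n : ℝ) ≤ x) → x ≤ n + 1 → (f (x + lo n * I)).im < 0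

lemma escapesInFiniteTime_of_tendsto {f : ℂ → ℂ} {Z : ℝ → ℂ} {B : ℝ}
    (hZ : ∀ t < B, HasDerivAt Z (f (Z t)) t)
    (hB : Tendsto Z (𝓝[<] B) (Bornology.cobounded ℂ)) :
    EscapesInFiniteTime f ⊥ (B : EReal) Z := by
  refine ⟨⟨⟨EReal.bot_lt_coe B, fun t _ ht => hZ t (EReal.coe_lt_coe_iff.1 ht)⟩, ?_⟩, B, rfl, hB⟩
  intro a b w hw ha hb hwZ
  refine ⟨le_bot_iff.1 ha, hb.antisymm' (not_lt.1 fun hlt => ?_)⟩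
  rw [le_bot_iff.1 ha] at hw
  have hc : Tendsto w (𝓝[<] B) (𝓝 (w B)) :=
    (hw.2 B (EReal.bot_lt_coe B) hlt).continuousAt.tendsto.mono_left nhdsWithin_le_nhds
  have hwB : Tendsto w (𝓝[<] B) (Bornology.cobounded ℂ) := by
    refine hB.congr' ?_
    filter_upwards [self_mem_nhdsWithin] with t ht
    exact (hwZ t (EReal.bot_lt_coe t) (EReal.coe_lt_coe_iff.2 ht)).symm
  exact hc.not_tendsto (Metric.disjoint_nhds_cobounded _) hwB

namespace IsFunnel

variable {f : ℂ → ℂ} {lo hi : ℕ → ℝ} {c : ℝ}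

lemma mem_tube_iff {x y : ℝ} : ((x : ℂ) + y * I) ∈ tube lo hi ↔
    y ∈ Icc (lo 0) (hi 0) ∧ ∀ m : ℕ, (m : ℝ) < x → y ∈ Icc (lo m) (hi m) := by
  simp [tube]

lemma mem_tube_of_le {x x' y : ℝ} (h : ((x : ℂ) + y * I) ∈ tube lo hi) (hx : x' ≤ x) :
    ((x' : ℂ) + y * I) ∈ tube lo hi := by
  rw [mem_tube_iff] at h ⊢
  exact ⟨h.1, fun m hm => h.2 m (hm.trans_le hx)⟩

lemma mem_tube_of_mem_uIcc {x y₁ y₂ y : ℝ} (h₁ : ((x : ℂ) + y₁ * I) ∈ tube lo hi)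
    (h₂ : ((x : ℂ) + y₂ * I) ∈ tube lo hi) (hy : y ∈ uIcc y₁ y₂) :
    ((x : ℂ) + y * I) ∈ tube lo hi := by
  rw [mem_tube_iff] at *
  exact ⟨uIcc_subset_Icc h₁.1 h₂.1 hy, fun m hm => uIcc_subset_Icc (h₁.2 m hm) (h₂.2 m hm) hy⟩

lemma mem_tube_of_le_succ (H : IsFunnel f lo hi c) {n : ℕ} {x y : ℝ} (hx : x ≤ n + 1)
    (hy : y ∈ Icc (lo n) (hi n)) : ((x : ℂ) + y * I) ∈ tube lo hi := by
  rw [mem_tube_iff]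
  have key : ∀ m : ℕ, m ≤ n → y ∈ Icc (lo m) (hi m) := fun m hm =>
    ⟨(H.lo_mono hm).trans hy.1, hy.2.trans (H.hi_anti hm)⟩
  refine ⟨key 0 (Nat.zero_le _), fun m hm => key m ?_⟩
  have : (m : ℝ) < (n + 1 : ℕ) := by push_cast; linarith
  exact Nat.lt_succ_iff.1 (by exact_mod_cast this)

lemma re_pos (H : IsFunnel f lo hi c) {z : ℂ} (hz : z ∈ tube lo hi) : 0 < (f z).re :=
  (mul_pos H.c_pos (Real.exp_pos _)).trans_le (H.le_re z hz)

lemma ne_zero (H : IsFunnel f lo hi c) {z : ℂ} (hz : z ∈ tube lo hi) : f z ≠ 0 := by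
  intro h
  have := H.re_pos hz
  simp [h] at this

lemma inv_re_pos (H : IsFunnel f lo hi c) {z : ℂ} (hz : z ∈ tube lo hi) : 0 < ((f z)⁻¹).re := by
  rw [inv_re]
  exact div_pos (H.re_pos hz) (normSq_pos.2 (H.ne_zero hz))

lemma abs_inv_im_le (H : IsFunnel f lo hi c) {z : ℂ} (hz : z ∈ tube lo hi) :
    |((f z)⁻¹).im| ≤ ((f z)⁻¹).re / 2 := by
  have h0 := normSq_pos.2 (H.ne_zero hz)
  rw [inv_re, inv_im, abs_div, abs_neg, abs_of_pos h0, div_right_comm]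
  exact div_le_div_of_nonneg_right (H.im_le z hz) h0.le

lemma inv_re_le (H : IsFunnel f lo hi c) {z : ℂ} (hz : z ∈ tube lo hi) :
    ((f z)⁻¹).re ≤ c⁻¹ * Real.exp (-z.re) := by
  have h0 := H.re_pos hz
  have h1 : ((f z)⁻¹).re ≤ ((f z).re)⁻¹ := by
    rw [inv_re, div_le_iff₀ (normSq_pos.2 (H.ne_zero hz)), normSq_apply]
    field_simp
    nlinarith [sq_nonneg (f z).im]
  refine h1.trans ?_
  rw [Real.exp_neg, ← mul_inv]
  exact inv_anti₀ (mul_pos H.c_pos (Real.exp_pos _)) (H.le_re z hz)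

lemma le_inv_re (H : IsFunnel f lo hi c) {z : ℂ} (hz : z ∈ tube lo hi) (hx : z.re ≤ 0) :
    1 / 4 ≤ ((f z)⁻¹).re := by
  have h0 := H.re_pos hz
  have h1 := H.im_le z hz
  have h2 := (re_le_norm (f z)).trans (H.norm_le z hz hx)
  have h3 : (f z).im ^ 2 ≤ ((f z).re / 2) ^ 2 := sq_le_sq' (by linarith [(abs_le.1 h1).1])
    (abs_le.1 h1).2
  rw [inv_re, le_div_iff₀ (normSq_pos.2 (H.ne_zero hz)), normSq_apply]
  nlinarith

lemma continuousOn_inv (H : IsFunnel f lo hi c) :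
    ContinuousOn (fun z => (f z)⁻¹) (tube lo hi) :=
  H.diff.continuous.continuousOn.inv₀ fun _ hz => H.ne_zero hz

lemma differentiableOn_inv (H : IsFunnel f lo hi c) :
    DifferentiableOn ℂ (fun z => (f z)⁻¹) (tube lo hi) :=
  H.diff.differentiableOn.inv fun _ hz => H.ne_zero hz

lemma continuousOn_hor (H : IsFunnel f lo hi c) {x₁ x₂ y : ℝ}
    (h₁ : ((x₁ : ℂ) + y * I) ∈ tube lo hi) (h₂ : ((x₂ : ℂ) + y * I) ∈ tube lo hi) :
    ContinuousOn (fun s : ℝ => (f (s + y * I))⁻¹) (uIcc x₁ x₂) := by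
  refine H.continuousOn_inv.comp (f := fun s : ℝ => (s : ℂ) + y * I) (by fun_prop) ?_
  intro s hs
  have : s ≤ max x₁ x₂ := hs.2
  rcases le_max_iff.1 this with h | h
  · exact mem_tube_of_le h₁ h
  · exact mem_tube_of_le h₂ h

lemma continuousOn_ver (H : IsFunnel f lo hi c) {x y₁ y₂ : ℝ}
    (h₁ : ((x : ℂ) + y₁ * I) ∈ tube lo hi) (h₂ : ((x : ℂ) + y₂ * I) ∈ tube lo hi) :
    ContinuousOn (fun s : ℝ => (f (x + s * I))⁻¹) (uIcc y₁ y₂) :=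
  H.continuousOn_inv.comp (f := fun s : ℝ => (x : ℂ) + s * I) (by fun_prop)
    fun _ hs => mem_tube_of_mem_uIcc h₁ h₂ hs

lemma mem_tube_zero {x y : ℝ} (h : ((x : ℂ) + y * I) ∈ tube lo hi) :
    (((0 : ℝ) : ℂ) + y * I) ∈ tube lo hi := by
  rw [mem_tube_iff] at *
  exact ⟨h.1, fun m hm => absurd hm (not_lt.2 (Nat.cast_nonneg m))⟩

lemma flowTime_hor (H : IsFunnel f lo hi c) {x₁ x₂ y : ℝ}
    (h₁ : ((x₁ : ℂ) + y * I) ∈ tube lo hi) (h₂ : ((x₂ : ℂ) + y * I) ∈ tube lo hi) :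
    flowTime f (x₂ + y * I) - flowTime f (x₁ + y * I) = ∫ s in x₁..x₂, (f (s + y * I))⁻¹ := by
  have h0 := mem_tube_zero h₁
  rw [← intervalIntegral.integral_interval_sub_left
    (H.continuousOn_hor h0 h₂).intervalIntegrable (H.continuousOn_hor h0 h₁).intervalIntegrable]
  simp [flowTime]

lemma flowTime_ver (H : IsFunnel f lo hi c) {x y₁ y₂ : ℝ}
    (h₁ : ((x : ℂ) + y₁ * I) ∈ tube lo hi) (h₂ : ((x : ℂ) + y₂ * I) ∈ tube lo hi) :
    flowTime f (x + y₂ * I) - flowTime f (x + y₁ * I) =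
      I * ∫ τ in y₁..y₂, (f (x + τ * I))⁻¹ := by
  have h01 := mem_tube_zero h₁
  have h02 := mem_tube_zero h₂
  have h00 : (((0 : ℝ) : ℂ) + ((0 : ℝ) : ℂ) * I) ∈ tube lo hi :=
    mem_tube_iff.2 ⟨H.zero_mem, fun m hm => absurd hm (not_lt.2 (Nat.cast_nonneg m))⟩
  have hrect := integral_boundary_rect_eq_zero_of_differentiableOn (fun z => (f z)⁻¹)
    (((0 : ℝ) : ℂ) + y₁ * I) ((x : ℂ) + y₂ * I) (H.differentiableOn_inv.mono (by
      rintro z ⟨hz1, hz2⟩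
      rw [mem_preimage] at hz1 hz2
      simp only [add_re, ofReal_re, mul_re, I_re, mul_zero, ofReal_im, I_im, mul_one, sub_self,
        add_zero, add_im, mul_im, zero_add] at hz1 hz2
      rw [← re_add_im z]
      have : z.re ≤ max 0 x := hz1.2
      rcases le_max_iff.1 this with h | h
      · exact mem_tube_of_le (mem_tube_of_mem_uIcc h01 h02 hz2) h
      · exact mem_tube_of_le (mem_tube_of_mem_uIcc h₁ h₂ hz2) h))
  have hsub := intervalIntegral.integral_interval_sub_left (μ := volume)
    (H.continuousOn_ver h00 h02).intervalIntegrable (H.continuousOn_ver h00 h01).intervalIntegrable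
  simp only [add_re, ofReal_re, mul_re, I_re, mul_zero, ofReal_im, I_im, mul_one, sub_self,
        add_zero, add_im, mul_im, zero_add, smul_eq_mul, ofReal_zero] at hrect hsub
  simp only [flowTime, add_re, ofReal_re, mul_re, I_re, mul_zero, ofReal_im, I_im, mul_one,
    sub_self, add_zero, add_im, mul_im, zero_add]
  linear_combination (-1 : ℂ) * hrect + I * hsub

lemma hasDerivAt_flowTime (H : IsFunnel f lo hi c) {z : ℂ} (hz : tube lo hi ∈ 𝓝 z) :
    HasDerivAt (flowTime f) (f z)⁻¹ z := by
  obtain ⟨r, hr, hball⟩ := Metric.mem_nhds_iff.1 hz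
  have hd := (H.differentiableOn_inv.mono hball)
  have hw := hd.isConservativeOn.hasDerivAt_wedgeIntegral hd.continuousOn (Metric.mem_ball_self hr)
  refine (hw.add_const (flowTime f z)).congr_of_eventuallyEq ?_
  filter_upwards [Metric.ball_mem_nhds z hr] with w hw
  have hw' : w ∈ tube lo hi := hball hw
  have hzz : z ∈ tube lo hi := hball (Metric.mem_ball_self hr)
  have hc : ((w.re : ℂ) + z.im * I) ∈ tube lo hi := by
    apply hball
    rw [Metric.mem_ball, dist_eq] at hw ⊢
    refine lt_of_le_of_lt ?_ hw
    have : (w.re : ℂ) + z.im * I - z = ((w - z).re : ℝ) := by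
      apply Complex.ext <;> simp
    rw [this, norm_real]
    exact abs_re_le_norm _
  rw [← re_add_im w] at hw'
  rw [← re_add_im z] at hzz
  have e1 := H.flowTime_hor hzz hc
  have e2 := H.flowTime_ver hc hw'
  rw [re_add_im] at e1 e2
  simp only [wedgeIntegral, smul_eq_mul]
  linear_combination e1 + e2

lemma intervalIntegral_re {F : ℝ → ℂ} {a b : ℝ} (h : ContinuousOn F (uIcc a b)) :
    (∫ s in a..b, F s).re = ∫ s in a..b, (F s).re :=
  (reCLM.intervalIntegral_comp_comm h.intervalIntegrable).symm

lemma intervalIntegral_im {F : ℝ → ℂ} {a b : ℝ} (h : ContinuousOn F (uIcc a b)) :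
    (∫ s in a..b, F s).im = ∫ s in a..b, (F s).im :=
  (imCLM.intervalIntegral_comp_comm h.intervalIntegrable).symm

lemma abs_intervalIntegral_im_le {F : ℝ → ℂ} {a b : ℝ} (hab : a ≤ b)
    (h : ContinuousOn F (uIcc a b)) (hF : ∀ s ∈ Icc a b, |(F s).im| ≤ (F s).re / 2) :
    |(∫ s in a..b, F s).im| ≤ (∫ s in a..b, F s).re / 2 := by
  have hre : ContinuousOn (fun s => (F s).re) (uIcc a b) := continuous_re.comp_continuousOn h
  have him : ContinuousOn (fun s => (F s).im) (uIcc a b) := continuous_im.comp_continuousOn h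
  rw [intervalIntegral_re h, intervalIntegral_im h, ← intervalIntegral.integral_div]
  exact (intervalIntegral.abs_integral_le_integral_abs hab).trans
    (intervalIntegral.integral_mono_on hab him.abs.intervalIntegrable
      (hre.div_const 2).intervalIntegrable hF)

lemma intervalIntegral_re_pos {F : ℝ → ℂ} {a b : ℝ} (hab : a < b)
    (h : ContinuousOn F (uIcc a b)) (hF : ∀ s ∈ Icc a b, 0 < (F s).re) :
    0 < (∫ s in a..b, F s).re := by
  rw [intervalIntegral_re h]
  exact intervalIntegral.intervalIntegral_pos_of_pos_on
    (continuous_re.comp_continuousOn h).intervalIntegrable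
    (fun s hs => hF s (Ioo_subset_Icc_self hs)) hab

variable (H : IsFunnel f lo hi c)
include H

lemma flowTime_hor_cone {x₁ x₂ y : ℝ} (hx : x₁ ≤ x₂) (h₂ : ((x₂ : ℂ) + y * I) ∈ tube lo hi) :
    |(flowTime f (x₂ + y * I) - flowTime f (x₁ + y * I)).im| ≤
      (flowTime f (x₂ + y * I) - flowTime f (x₁ + y * I)).re / 2 := by
  have h₁ := mem_tube_of_le h₂ hx
  rw [H.flowTime_hor h₁ h₂]
  exact abs_intervalIntegral_im_le hx (H.continuousOn_hor h₁ h₂)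
    fun s hs => H.abs_inv_im_le (mem_tube_of_le h₂ hs.2)

lemma flowTime_hor_pos {x₁ x₂ y : ℝ} (hx : x₁ < x₂) (h₂ : ((x₂ : ℂ) + y * I) ∈ tube lo hi) :
    0 < (flowTime f (x₂ + y * I) - flowTime f (x₁ + y * I)).re := by
  have h₁ := mem_tube_of_le h₂ hx.le
  rw [H.flowTime_hor h₁ h₂]
  exact intervalIntegral_re_pos hx (H.continuousOn_hor h₁ h₂)
    fun s hs => H.inv_re_pos (mem_tube_of_le h₂ hs.2)

lemma flowTime_hor_le {x₁ x₂ y : ℝ} (hx : x₁ ≤ x₂) (h₂ : ((x₂ : ℂ) + y * I) ∈ tube lo hi) :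
    (flowTime f (x₂ + y * I) - flowTime f (x₁ + y * I)).re ≤
      c⁻¹ * (Real.exp (-x₁) - Real.exp (-x₂)) := by
  have h₁ := mem_tube_of_le h₂ hx
  have hc := H.continuousOn_hor h₁ h₂
  have hexp : ∫ s in x₁..x₂, c⁻¹ * Real.exp (-s) =
      c⁻¹ * (Real.exp (-x₁) - Real.exp (-x₂)) := by
    rw [intervalIntegral.integral_const_mul, intervalIntegral.integral_comp_neg, integral_exp]
  rw [H.flowTime_hor h₁ h₂, intervalIntegral_re hc, ← hexp]
  refine intervalIntegral.integral_mono_on hx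
    (continuous_re.comp_continuousOn hc).intervalIntegrable
    (Continuous.intervalIntegrable (by fun_prop) _ _) fun s hs => ?_
  simpa using H.inv_re_le (mem_tube_of_le h₂ hs.2)

lemma le_flowTime_hor {x₁ x₂ y : ℝ} (hx : x₁ ≤ x₂) (hx₂ : x₂ ≤ 0)
    (h₂ : ((x₂ : ℂ) + y * I) ∈ tube lo hi) :
    (x₂ - x₁) / 4 ≤ (flowTime f (x₂ + y * I) - flowTime f (x₁ + y * I)).re := by
  have h₁ := mem_tube_of_le h₂ hx
  have hc := H.continuousOn_hor h₁ h₂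
  have hconst : ∫ s in x₁..x₂, (1 / 4 : ℝ) = (x₂ - x₁) / 4 := by
    rw [intervalIntegral.integral_const, smul_eq_mul]; ring
  rw [H.flowTime_hor h₁ h₂, intervalIntegral_re hc, ← hconst]
  refine intervalIntegral.integral_mono_on hx (Continuous.intervalIntegrable (by fun_prop) _ _)
    (continuous_re.comp_continuousOn hc).intervalIntegrable fun s hs => ?_
  exact H.le_inv_re (mem_tube_of_le h₂ hs.2) (by simpa using hs.2.trans hx₂)

lemma flowTime_ver_cone {x y₁ y₂ : ℝ} (hy : y₁ ≤ y₂) (h₁ : ((x : ℂ) + y₁ * I) ∈ tube lo hi)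
    (h₂ : ((x : ℂ) + y₂ * I) ∈ tube lo hi) :
    |(flowTime f (x + y₂ * I) - flowTime f (x + y₁ * I)).re| ≤
      (flowTime f (x + y₂ * I) - flowTime f (x + y₁ * I)).im / 2 := by
  rw [H.flowTime_ver h₁ h₂, I_mul_re, I_mul_im, abs_neg]
  exact abs_intervalIntegral_im_le hy (H.continuousOn_ver h₁ h₂) fun s hs =>
    H.abs_inv_im_le (mem_tube_of_mem_uIcc h₁ h₂ (by rwa [uIcc_of_le hy]))

lemma flowTime_ver_pos {x y₁ y₂ : ℝ} (hy : y₁ < y₂) (h₁ : ((x : ℂ) + y₁ * I) ∈ tube lo hi)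
    (h₂ : ((x : ℂ) + y₂ * I) ∈ tube lo hi) :
    (flowTime f (x + y₁ * I)).im < (flowTime f (x + y₂ * I)).im := by
  rw [← sub_pos, ← sub_im, H.flowTime_ver h₁ h₂, I_mul_im]
  exact intervalIntegral_re_pos hy (H.continuousOn_ver h₁ h₂) fun s hs =>
    H.inv_re_pos (mem_tube_of_mem_uIcc h₁ h₂ (by rwa [uIcc_of_le hy.le]))

lemma eq_of_flowTime_im_eq {x y₁ y₂ : ℝ} (h₁ : ((x : ℂ) + y₁ * I) ∈ tube lo hi)
    (h₂ : ((x : ℂ) + y₂ * I) ∈ tube lo hi)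
    (h : (flowTime f (x + y₁ * I)).im = (flowTime f (x + y₂ * I)).im) : y₁ = y₂ := by
  rcases lt_trichotomy y₁ y₂ with hy | hy | hy
  · exact absurd h (H.flowTime_ver_pos hy h₁ h₂).ne
  · exact hy
  · exact absurd h (H.flowTime_ver_pos hy h₂ h₁).ne'

/-- Two points of the tube on the same trajectory: the time between them is comparable to the
time along the horizontal segment. -/
lemma flowTime_re_bounds {x₁ x₂ y₁ y₂ : ℝ} (hx : x₁ ≤ x₂)
    (h₁ : ((x₁ : ℂ) + y₁ * I) ∈ tube lo hi) (h₂ : ((x₂ : ℂ) + y₂ * I) ∈ tube lo hi)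
    (h : (flowTime f (x₁ + y₁ * I)).im = (flowTime f (x₂ + y₂ * I)).im) :
    (flowTime f (x₂ + y₂ * I) - flowTime f (x₁ + y₂ * I)).re / 2 ≤
        (flowTime f (x₂ + y₂ * I)).re - (flowTime f (x₁ + y₁ * I)).re ∧
      (flowTime f (x₂ + y₂ * I)).re - (flowTime f (x₁ + y₁ * I)).re ≤
        2 * (flowTime f (x₂ + y₂ * I) - flowTime f (x₁ + y₂ * I)).re := by
  have h₃ := mem_tube_of_le h₂ hx
  have hA := abs_le.1 (H.flowTime_hor_cone hx h₂)
  rcases le_total y₁ y₂ with hy | hy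
  · have hB := abs_le.1 (H.flowTime_ver_cone hy h₁ h₃)
    simp only [sub_re, sub_im] at *
    constructor <;> linarith
  · have hB := abs_le.1 (H.flowTime_ver_cone hy h₃ h₁)
    simp only [sub_re, sub_im] at *
    constructor <;> linarith

/-- Along the upper side of a window the imaginary part of `flowTime` decreases. -/
lemma flowTime_hi_lt {n : ℕ} {x₁ x₂ : ℝ} (hn : n = 0 ∨ (n : ℝ) ≤ x₁) (hx : x₁ < x₂)
    (hx₂ : x₂ ≤ n + 1) :
    (flowTime f (x₂ + hi n * I)).im < (flowTime f (x₁ + hi n * I)).im := by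
  have h₂ : ((x₂ : ℂ) + hi n * I) ∈ tube lo hi :=
    H.mem_tube_of_le_succ hx₂ ⟨(H.lo_lt_hi n).le, le_rfl⟩
  have h₁ := mem_tube_of_le h₂ hx.le
  have hc := H.continuousOn_hor h₁ h₂
  rw [← sub_pos, ← sub_im, ← neg_sub, H.flowTime_hor h₁ h₂, neg_im,
    intervalIntegral_im hc, ← intervalIntegral.integral_neg]
  refine intervalIntegral.intervalIntegral_pos_of_pos_on
    (continuous_im.comp_continuousOn hc).neg.intervalIntegrable (fun s hs => ?_) hx
  rw [inv_im, neg_div, neg_neg]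
  exact div_pos (H.hi_side n s (hn.imp_right fun h => h.trans hs.1.le) (hs.2.le.trans hx₂))
    (normSq_pos.2 (H.ne_zero (mem_tube_of_le h₂ hs.2.le)))

/-- Along the lower side of a window the imaginary part of `flowTime` increases. -/
lemma flowTime_lo_lt {n : ℕ} {x₁ x₂ : ℝ} (hn : n = 0 ∨ (n : ℝ) ≤ x₁) (hx : x₁ < x₂)
    (hx₂ : x₂ ≤ n + 1) :
    (flowTime f (x₁ + lo n * I)).im < (flowTime f (x₂ + lo n * I)).im := by
  have h₂ : ((x₂ : ℂ) + lo n * I) ∈ tube lo hi :=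
    H.mem_tube_of_le_succ hx₂ ⟨le_rfl, (H.lo_lt_hi n).le⟩
  have h₁ := mem_tube_of_le h₂ hx.le
  have hc := H.continuousOn_hor h₁ h₂
  rw [← sub_pos, ← sub_im, H.flowTime_hor h₁ h₂, intervalIntegral_im hc]
  refine intervalIntegral.intervalIntegral_pos_of_pos_on
    (continuous_im.comp_continuousOn hc).intervalIntegrable (fun s hs => ?_) hx
  rw [inv_im]
  exact div_pos (neg_pos.2 (H.lo_side n s (hn.imp_right fun h => h.trans hs.1.le)
    (hs.2.le.trans hx₂))) (normSq_pos.2 (H.ne_zero (mem_tube_of_le h₂ hs.2.le)))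

/-- A level of `Im flowTime` that lies strictly between its values on the lower and the upper
side of the tube, over every vertical line. -/
lemma exists_level : ∃ d : ℝ, ∀ x : ℝ, (flowTime f (x + lo ⌊x⌋₊ * I)).im < d ∧
    d < (flowTime f (x + hi ⌊x⌋₊ * I)).im := by
  set P : ℕ → ℝ := fun n => (flowTime f ((n : ℝ) + lo n * I)).im with hP
  set Q : ℕ → ℝ := fun n => (flowTime f ((n : ℝ) + hi n * I)).im with hQ
  have hlo : ∀ n, lo n ∈ Icc (lo n) (hi n) := fun n => ⟨le_rfl, (H.lo_lt_hi n).le⟩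
  have hhi : ∀ n, hi n ∈ Icc (lo n) (hi n) := fun n => ⟨(H.lo_lt_hi n).le, le_rfl⟩
  have hver : ∀ {x y₁ y₂ : ℝ}, y₁ ≤ y₂ → ((x : ℂ) + y₁ * I) ∈ tube lo hi →
      ((x : ℂ) + y₂ * I) ∈ tube lo hi →
      (flowTime f (x + y₁ * I)).im ≤ (flowTime f (x + y₂ * I)).im := by
    intro x y₁ y₂ hy h₁ h₂
    rcases hy.eq_or_lt with rfl | hy
    · exact le_rfl
    · exact (H.flowTime_ver_pos hy h₁ h₂).le
  have hP1 : ∀ (n : ℕ) (x : ℝ), (n = 0 ∨ (n : ℝ) ≤ x) → x < n + 1 →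
      (flowTime f (x + lo n * I)).im < P (n + 1) := by
    intro n x hn hx
    refine (H.flowTime_lo_lt hn hx le_rfl).trans_le ?_
    have := hver (x := n + 1) (H.lo_mono (Nat.le_succ n)) (H.mem_tube_of_le_succ le_rfl (hlo n))
      (H.mem_tube_of_le_succ (by push_cast; linarith) (hlo (n + 1)))
    simpa [hP] using this
  have hQ1 : ∀ (n : ℕ) (x : ℝ), (n = 0 ∨ (n : ℝ) ≤ x) → x < n + 1 →
      Q (n + 1) < (flowTime f (x + hi n * I)).im := by
    intro n x hn hx
    refine lt_of_le_of_lt ?_ (H.flowTime_hi_lt hn hx le_rfl)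
    have := hver (x := n + 1) (H.hi_anti (Nat.le_succ n))
      (H.mem_tube_of_le_succ (by push_cast; linarith) (hhi (n + 1)))
      (H.mem_tube_of_le_succ le_rfl (hhi n))
    simpa [hQ] using this
  have hPm : Monotone P := monotone_nat_of_le_succ fun n => (hP1 n n (Or.inr le_rfl) (by simp)).le
  have hQm : Antitone Q := antitone_nat_of_succ_le fun n => (hQ1 n n (Or.inr le_rfl) (by simp)).le
  have hPQ : P ≤ Q := fun n => hver (H.lo_lt_hi n).le
    (H.mem_tube_of_le_succ (by simp) (hlo n)) (H.mem_tube_of_le_succ (by simp) (hhi n))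
  have hd := mem_iInter.1 (hPm.ciSup_mem_iInter_Icc_of_antitone hQm hPQ)
  refine ⟨⨆ n, P n, fun x => ?_⟩
  have hn : ⌊x⌋₊ = 0 ∨ (⌊x⌋₊ : ℝ) ≤ x := by
    rcases le_total 0 x with h | h
    · exact Or.inr (Nat.floor_le h)
    · exact Or.inl (Nat.floor_of_nonpos h)
  have hx := Nat.lt_floor_add_one x
  exact ⟨(hP1 _ x hn hx).trans_le (hd _).1, (hd _).2.trans_lt (hQ1 _ x hn hx)⟩

lemma exists_mem_level {d : ℝ} (hd : ∀ x : ℝ, (flowTime f (x + lo ⌊x⌋₊ * I)).im < d ∧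
    d < (flowTime f (x + hi ⌊x⌋₊ * I)).im) (x : ℝ) :
    ∃ y ∈ Ioo (lo ⌊x⌋₊) (hi ⌊x⌋₊), (flowTime f (x + y * I)).im = d := by
  set n := ⌊x⌋₊
  have hmem : ∀ y ∈ Icc (lo n) (hi n), ((x : ℂ) + y * I) ∈ tube lo hi := fun y hy =>
    H.mem_tube_of_le_succ (Nat.lt_floor_add_one x).le hy
  have hlt := H.lo_lt_hi n
  have hl := hmem _ (left_mem_Icc.2 hlt.le)
  have hh := hmem _ (right_mem_Icc.2 hlt.le)
  have hcont : ContinuousOn (fun y : ℝ => (flowTime f (x + y * I)).im) (Icc (lo n) (hi n)) := by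
    have h1 := (intervalIntegral.continuousOn_primitive_interval' (μ := volume)
      (H.continuousOn_ver hl hh).intervalIntegrable left_mem_uIcc)
    rw [uIcc_of_le hlt.le] at h1
    have h2 : ContinuousOn (fun y : ℝ => flowTime f (x + lo n * I) +
        I * ∫ τ in lo n..y, (f (x + τ * I))⁻¹) (Icc (lo n) (hi n)) := by fun_prop
    refine continuous_im.comp_continuousOn (h2.congr fun y hy => ?_)
    linear_combination H.flowTime_ver hl (hmem y hy)
  obtain ⟨y, hy, hyd⟩ := intermediate_value_Ioo hlt.le hcont (hd x)
  exact ⟨y, hy, hyd⟩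

lemma tube_mem_nhds {z : ℂ} (hz : z.im ∈ Ioo (lo ⌊z.re⌋₊) (hi ⌊z.re⌋₊)) : tube lo hi ∈ 𝓝 z := by
  have h1 : ∀ᶠ w : ℂ in 𝓝 z, w.re < ⌊z.re⌋₊ + 1 :=
    continuous_re.continuousAt.eventually_lt continuousAt_const (Nat.lt_floor_add_one _)
  have h2 : ∀ᶠ w : ℂ in 𝓝 z, w.im ∈ Ioo (lo ⌊z.re⌋₊) (hi ⌊z.re⌋₊) :=
    continuous_im.continuousAt.eventually (isOpen_Ioo.mem_nhds hz)
  filter_upwards [h1, h2] with w hw1 hw2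
  rw [← re_add_im w]
  exact H.mem_tube_of_le_succ hw1.le (Ioo_subset_Icc_self hw2)

lemma hasStrictDerivAt_flowTime {z : ℂ} (hz : tube lo hi ∈ 𝓝 z) :
    HasStrictDerivAt (flowTime f) (f z)⁻¹ z := by
  have hd : DifferentiableOn ℂ (flowTime f) (interior (tube lo hi)) := fun w hw =>
    (H.hasDerivAt_flowTime (mem_interior_iff_mem_nhds.1 hw)).differentiableAt.differentiableWithinAt
  have ha : AnalyticAt ℂ (flowTime f) z :=
    hd.analyticAt (isOpen_interior.mem_nhds (mem_interior_iff_mem_nhds.2 hz))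
  have := ha.hasStrictDerivAt
  rwa [(H.hasDerivAt_flowTime hz).deriv] at this

/-- Every funnel contains a trajectory that escapes to infinity in finite time; it lies on a level
set of `Im flowTime` and meets every vertical line in the interior of the tube. -/
lemma exists_escaping : ∃ (d B : ℝ) (Z : ℝ → ℂ),
    EscapesInFiniteTime f ⊥ (B : EReal) Z ∧
    (∀ t < B, Z t ∈ tube lo hi ∧ (flowTime f (Z t)).im = d) ∧
    ∀ x : ℝ, ∃ t < B, (Z t).re = x ∧ (Z t).im ∈ Ioo (lo ⌊x⌋₊) (hi ⌊x⌋₊) := by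
  obtain ⟨d, hd⟩ := H.exists_level
  choose y hy hyd using H.exists_mem_level hd
  set ζ : ℝ → ℂ := fun x => (x : ℂ) + y x * I with hζ
  set τ : ℝ → ℝ := fun x => (flowTime f (ζ x)).re with hτ
  have hmem : ∀ x, ζ x ∈ tube lo hi := fun x =>
    H.mem_tube_of_le_succ (Nat.lt_floor_add_one x).le (Ioo_subset_Icc_self (hy x))
  have hnhds : ∀ x, tube lo hi ∈ 𝓝 (ζ x) := fun x => H.tube_mem_nhds (by simpa [hζ] using hy x)
  have hpos : ∀ {x₁ x₂ : ℝ}, x₁ < x₂ → τ x₁ < τ x₂ := fun {x₁ x₂} h => by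
    have h1 := (H.flowTime_re_bounds h.le (hmem x₁) (hmem x₂) ((hyd x₁).trans (hyd x₂).symm)).1
    have h2 := H.flowTime_hor_pos h (hmem x₂)
    simp only [hτ, hζ]
    linarith
  have hmono : StrictMono τ := fun _ _ h => hpos h
  set g : ℝ → ℝ := fun x => -(2 * (c⁻¹ * Real.exp (-x))) with hg
  have hle : ∀ {x₁ x₂ : ℝ}, x₁ ≤ x₂ → τ x₂ - τ x₁ ≤ g x₂ - g x₁ := fun {x₁ x₂} h => by
    have h1 := (H.flowTime_re_bounds h (hmem x₁) (hmem x₂) ((hyd x₁).trans (hyd x₂).symm)).2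
    have h2 := H.flowTime_hor_le h (hmem x₂)
    simp only [hτ, hζ, hg]
    linarith
  have hneg : ∀ x ≤ 0, τ x ≤ τ 0 + x / 8 := fun x h => by
    have h1 := (H.flowTime_re_bounds h (hmem x) (hmem 0) ((hyd x).trans (hyd 0).symm)).1
    have h2 := H.le_flowTime_hor h le_rfl (hmem 0)
    simp only [hτ, hζ]
    linarith
  have hcont : Continuous τ := by
    have hgc : Continuous g := by fun_prop
    refine continuous_iff_continuousAt.2 fun x₀ => ?_
    rw [ContinuousAt, tendsto_iff_dist_tendsto_zero]
    have hg0 := tendsto_iff_dist_tendsto_zero.1 (hgc.tendsto x₀)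
    refine squeeze_zero (fun _ => dist_nonneg) (fun x => ?_) hg0
    rw [Real.dist_eq, Real.dist_eq]
    rcases le_total x x₀ with h | h
    · rw [abs_sub_comm, abs_sub_comm (g x), abs_of_nonneg (sub_nonneg.2 (hmono.monotone h))]
      exact (hle h).trans (le_abs_self _)
    · rw [abs_of_nonneg (sub_nonneg.2 (hmono.monotone h))]
      exact (hle h).trans (le_abs_self _)
  have hbdd : BddAbove (range τ) := by
    refine ⟨τ 0 - g 0, ?_⟩
    rintro _ ⟨x, rfl⟩
    have hgx : ∀ x, g x ≤ 0 := fun x =>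
      neg_nonpos.2 (mul_nonneg zero_le_two (mul_nonneg (inv_nonneg.2 H.c_pos.le)
        (Real.exp_pos _).le))
    rcases le_total x 0 with h | h
    · linarith [hmono.monotone h, hgx 0]
    · linarith [hle h, hgx x]
  set B := sSup (range τ) with hB
  have hltB : ∀ x, τ x < B := fun x =>
    (hpos (lt_add_one x)).trans_le (le_csSup hbdd (mem_range_self _))
  have hsurj : ∀ t < B, ∃ x, τ x = t := fun t ht => by
    obtain ⟨_, ⟨x₂, rfl⟩, hx₂⟩ := exists_lt_of_lt_csSup (range_nonempty τ) ht
    refine mem_range_of_exists_le_of_exists_ge hcont ⟨min 0 (8 * (t - τ 0)), ?_⟩ ⟨x₂, hx₂.le⟩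
    linarith [hneg _ (min_le_left 0 (8 * (t - τ 0))), min_le_right 0 (8 * (t - τ 0))]
  set X : ℝ → ℝ := Function.invFun τ with hX
  have hXτ : ∀ x, X (τ x) = x := Function.leftInverse_invFun hmono.injective
  have hτX : ∀ t < B, τ (X t) = t := fun t ht => Function.invFun_eq (hsurj t ht)
  refine ⟨d, B, fun t => ζ (X t), escapesInFiniteTime_of_tendsto ?_ ?_,
    fun t _ => ⟨hmem _, hyd _⟩, fun x => ⟨τ x, hltB x, ?_⟩⟩
  · intro t ht
    set z₀ := ζ (X t) with hz₀
    have hT : flowTime f z₀ = (t : ℂ) + d * I := by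
      apply Complex.ext
      · simpa using hτX t ht
      · simpa using hyd (X t)
    have hS := H.hasStrictDerivAt_flowTime (hnhds (X t))
    have hne : (f z₀)⁻¹ ≠ 0 := inv_ne_zero (H.ne_zero (hmem _))
    set ψ := hS.localInverse (flowTime f) _ z₀ hne with hψ
    have hψd : HasDerivAt ψ (f z₀) (flowTime f z₀) := by
      simpa using (hS.to_localInverse hne).hasDerivAt
    have hψ0 : ψ (flowTime f z₀) = z₀ := HasStrictFDerivAt.localInverse_apply_image _
    have hψr : ∀ᶠ w in 𝓝 (flowTime f z₀), flowTime f (ψ w) = w :=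
      HasStrictFDerivAt.eventually_right_inverse _
    have hψt : ∀ᶠ w in 𝓝 (flowTime f z₀), ψ w ∈ tube lo hi :=
      hψd.continuousAt.eventually_mem (by rw [hψ0]; exact hnhds _)
    have hline : HasDerivAt (fun s : ℝ => (s : ℂ) + d * I) 1 t :=
      (hasDerivAt_id t).ofReal_comp.add_const _
    have hcomp : HasDerivAt (fun s : ℝ => ψ ((s : ℂ) + d * I)) (f z₀) t := by
      rw [hT] at hψd
      have := hψd.comp t hline
      rwa [mul_one] at this
    refine hcomp.congr_of_eventuallyEq ?_
    have htend : Tendsto (fun s : ℝ => (s : ℂ) + d * I) (𝓝 t) (𝓝 (flowTime f z₀)) := by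
      rw [hT]; exact hline.continuousAt.tendsto
    filter_upwards [htend.eventually hψr, htend.eventually hψt, Iio_mem_nhds ht] with s hs1 hs2 _
    set w := ψ ((s : ℂ) + d * I) with hw
    have hwζ : w = ζ w.re := by
      have h1 : ((w.re : ℂ) + w.im * I) ∈ tube lo hi := by rwa [re_add_im]
      have h2 := H.eq_of_flowTime_im_eq h1 (hmem w.re) (by
        rw [re_add_im, hs1]; simpa using (hyd w.re).symm)
      rw [hζ]
      simp only
      rw [← h2, re_add_im]
    have hτw : τ w.re = s := by
      simp only [hτ]
      rw [← hwζ, hs1]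
      simp
    have hXs : X s = w.re := by rw [← hXτ w.re, hτw]
    simp only [hXs]
    exact hwζ.symm
  · rw [← tendsto_norm_atTop_iff_cobounded, tendsto_atTop]
    intro R
    filter_upwards [Ioo_mem_nhdsLT (hltB R)] with t ht
    have h1 : R < X t := hmono.lt_iff_lt.1 (by rw [hτX t ht.2]; exact ht.1)
    have h2 := re_le_norm (ζ (X t))
    simp only [hζ, add_re, ofReal_re, mul_re, I_re, mul_zero, ofReal_im, I_im, zero_mul, sub_zero,
      add_zero] at h2 ⊢
    linarith
  · simp only [hXτ]
    simpa [hζ] using hy x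

end IsFunnel

/-- The exponents of the lacunary exponential series. -/
def freq (n : ℕ) : ℝ := 65536 ^ n

/-- The coefficients of the lacunary exponential series: consecutive terms of the series have
ratio `1 / 16` in modulus on the line `re = n + 1`. -/
def coef : ℕ → ℝ
  | 0 => 1
  | n + 1 => coef n * (Real.exp (-((freq (n + 1) - freq n) * (n + 1))) / 16)

/-- The modulus of the `n`-th term of the series on the line `re = x`. -/
def size (n : ℕ) (x : ℝ) : ℝ := coef n * Real.exp (freq n * x)

/-- The terms of the series. -/
def expTerm (n : ℕ) (z : ℂ) : ℂ := coef n * cexp (freq n * z)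

/-- A lacunary exponential series. -/
def expSeries (z : ℂ) : ℂ := ∑' n, expTerm n z

lemma freq_pos (n : ℕ) : 0 < freq n := by unfold freq; positivity

lemma freq_succ (n : ℕ) : freq (n + 1) = 65536 * freq n := by
  simp only [freq, pow_succ]; ring

lemma one_le_freq (n : ℕ) : 1 ≤ freq n := one_le_pow₀ (by norm_num)

lemma coef_pos : ∀ n, 0 < coef n
  | 0 => one_pos
  | n + 1 => mul_pos (coef_pos n) (by positivity)

lemma size_pos (n : ℕ) (x : ℝ) : 0 < size n x := mul_pos (coef_pos n) (Real.exp_pos _)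

lemma size_zero (x : ℝ) : size 0 x = Real.exp x := by simp [size, coef, freq]

lemma size_mono (n : ℕ) : Monotone (size n) := fun _ _ h =>
  mul_le_mul_of_nonneg_left (Real.exp_le_exp.2 (mul_le_mul_of_nonneg_left h (freq_pos n).le))
    (coef_pos n).le

lemma norm_expTerm (n : ℕ) (z : ℂ) : ‖expTerm n z‖ = size n z.re := by
  rw [expTerm, norm_mul, norm_real, Real.norm_of_nonneg (coef_pos n).le, Complex.norm_exp,
    re_ofReal_mul, size]

lemma size_succ (n : ℕ) (x : ℝ) :
    size (n + 1) x = size n x * Real.exp ((freq (n + 1) - freq n) * (x - (n + 1))) / 16 := by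
  have : Real.exp (-((freq (n + 1) - freq n) * (n + 1))) * Real.exp (freq (n + 1) * x) =
      Real.exp (freq n * x) * Real.exp ((freq (n + 1) - freq n) * (x - (n + 1))) := by
    rw [← Real.exp_add, ← Real.exp_add]; ring_nf
  rw [size, size, coef]
  linear_combination coef n / 16 * this

lemma freq_sub_pos (n : ℕ) : 65535 ≤ freq (n + 1) - freq n := by
  rw [freq_succ]; linarith [one_le_freq n]

lemma size_succ_le {n : ℕ} {x : ℝ} (hx : x ≤ n + 1) : size (n + 1) x ≤ size n x / 16 := by
  rw [size_succ]
  have : Real.exp ((freq (n + 1) - freq n) * (x - (n + 1))) ≤ 1 :=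
    Real.exp_le_one_iff.2 (mul_nonpos_of_nonneg_of_nonpos (by linarith [freq_sub_pos n])
      (by linarith))
  nlinarith [size_pos n x]

lemma size_le_succ {n : ℕ} {x : ℝ} (hx : n + 1 ≤ x) : size n x ≤ 16 * size (n + 1) x := by
  rw [size_succ]
  have : 1 ≤ Real.exp ((freq (n + 1) - freq n) * (x - (n + 1))) :=
    Real.one_le_exp (mul_nonneg (by linarith [freq_sub_pos n]) (by linarith))
  nlinarith [size_pos n x]

lemma mul_size_le_succ {n : ℕ} {x : ℝ} (hx : n + 2 ≤ x) : 4096 * size n x ≤ size (n + 1) x := by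
  rw [size_succ]
  have h1 := freq_sub_pos n
  have : 65536 ≤ Real.exp ((freq (n + 1) - freq n) * (x - (n + 1))) := by
    refine le_trans ?_ (Real.add_one_le_exp _)
    nlinarith
  nlinarith [size_pos n x]

lemma size_add_le {n : ℕ} {x : ℝ} (hx : x ≤ n + 1) (k : ℕ) :
    size (n + k) x ≤ size n x * (1 / 16) ^ k := by
  induction k with
  | zero => simp
  | succ k ih =>
    have := size_succ_le (n := n + k) (x := x) (by push_cast; linarith [Nat.cast_nonneg (α := ℝ) k])
    rw [← add_assoc, pow_succ]
    linarith

lemma summable_size (x : ℝ) : Summable fun n => size n x := by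
  rw [← summable_nat_add_iff ⌈x⌉₊]
  have hg : Summable fun k : ℕ => size ⌈x⌉₊ x * (1 / 16 : ℝ) ^ k :=
    (summable_geometric_of_lt_one (by norm_num) (by norm_num)).mul_left _
  refine hg.of_nonneg_of_le (fun k => (size_pos _ _).le) fun k => ?_
  rw [add_comm]
  exact size_add_le ((Nat.le_ceil x).trans (by simp)) k

lemma summable_expTerm (z : ℂ) : Summable fun n => expTerm n z :=
  .of_norm (by simpa only [norm_expTerm] using summable_size z.re)

lemma differentiable_expSeries : Differentiable ℂ expSeries := by
  intro z
  have hU : IsOpen {w : ℂ | w.re < z.re + 1} := isOpen_lt continuous_re continuous_const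
  refine (differentiableOn_tsum_of_summable_norm (summable_size (z.re + 1))
    (fun n w _ => ?_) hU fun n w hw => ?_).differentiableAt (hU.mem_nhds (by simp))
  · unfold expTerm
    fun_prop
  · rw [norm_expTerm]
    exact size_mono n (le_of_lt hw)

lemma norm_tail_le {n : ℕ} {z : ℂ} (hx : z.re ≤ n + 1) :
    ‖∑' k, expTerm (k + (n + 1)) z‖ ≤ size n z.re / 15 := by
  have hg := (hasSum_geometric_of_lt_one (r := (1 / 16 : ℝ)) (by norm_num) (by norm_num)).mul_left
    (size n z.re / 16)
  have hle : ∀ k, ‖expTerm (k + (n + 1)) z‖ ≤ size n z.re / 16 * (1 / 16) ^ k := fun k => by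
    rw [norm_expTerm, show k + (n + 1) = n + (1 + k) by ring]
    refine (size_add_le hx (1 + k)).trans_eq ?_
    rw [pow_add]; ring
  refine (tsum_of_norm_bounded hg hle).trans_eq ?_
  norm_num
  ring

lemma expSeries_eq (n : ℕ) (z : ℂ) : expSeries z =
    ∑ m ∈ Finset.range n, expTerm m z + expTerm n z + ∑' k, expTerm (k + (n + 1)) z := by
  rw [← Finset.sum_range_succ, (summable_expTerm z).sum_add_tsum_nat_add, expSeries]

lemma sum_size_le {n : ℕ} {x : ℝ} (hx : n + 1 ≤ x) :
    ∑ m ∈ Finset.range n, size m x ≤ size n x / 1024 := by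
  induction n with
  | zero => simp [(size_pos 0 x).le, div_nonneg]
  | succ n ih =>
    push_cast at hx
    rw [Finset.sum_range_succ]
    have h1 := ih (by linarith)
    have h2 := mul_size_le_succ (n := n) (x := x) (by linarith)
    linarith [size_pos n x]

lemma exp_le_size {n : ℕ} {x : ℝ} (hn : n = 0 ∨ (n : ℝ) ≤ x) : Real.exp x ≤ 32 * size n x := by
  rw [← size_zero]
  rcases n with _ | n
  · linarith [size_pos 0 x]
  · have hx : (n : ℝ) + 1 ≤ x := by simpa using hn
    have h0 : size 0 x ≤ ∑ m ∈ Finset.range (n + 1), size m x :=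
      Finset.single_le_sum (f := fun m => size m x) (fun m _ => (size_pos m x).le) (by simp)
    rw [Finset.sum_range_succ] at h0
    linarith [sum_size_le hx, size_le_succ hx, size_pos n x]

lemma expSeries_add_two_pi (z : ℂ) (k : ℕ) : expSeries (z + k * (2 * Real.pi * I)) =
    expSeries z := by
  refine tsum_congr fun n => ?_
  have : (freq n : ℂ) * (z + k * (2 * Real.pi * I)) =
      freq n * z + (65536 ^ n * k : ℕ) * (2 * Real.pi * I) := by
    simp only [freq]; push_cast; ring
  rw [expTerm, expTerm, this, exp_periodic.nat_mul]

/-- The `n`-th window of the nested family with address `σ` is centred at `windowMid σ n`. -/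
def windowMid (σ : ℕ → Bool) (n : ℕ) : ℝ :=
  ∑ j ∈ Finset.range n, if σ j then 2 * Real.pi / freq (j + 1) else 0

/-- Lower ends of the windows with address `σ`. -/
def windowLo (σ : ℕ → Bool) (n : ℕ) : ℝ := windowMid σ n - 1 / (4 * freq n)

/-- Upper ends of the windows with address `σ`. -/
def windowHi (σ : ℕ → Bool) (n : ℕ) : ℝ := windowMid σ n + 1 / (4 * freq n)

section Windows

variable (σ : ℕ → Bool)

lemma windowMid_succ (n : ℕ) : windowMid σ (n + 1) =
    windowMid σ n + if σ n then 2 * Real.pi / freq (n + 1) else 0 := by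
  simp only [windowMid, Finset.sum_range_succ]

lemma windowMid_le_succ (n : ℕ) : windowMid σ n ≤ windowMid σ (n + 1) := by
  have := freq_pos (n + 1)
  rw [windowMid_succ]
  split_ifs
  · have := Real.pi_pos
    have : 0 ≤ 2 * Real.pi / freq (n + 1) := by positivity
    linarith
  · simp

lemma windowMid_succ_le (n : ℕ) :
    windowMid σ (n + 1) ≤ windowMid σ n + 2 * Real.pi / freq (n + 1) := by
  have := freq_pos (n + 1)
  have := Real.pi_pos
  rw [windowMid_succ]
  split_ifs
  · exact le_rfl
  · have : 0 ≤ 2 * Real.pi / freq (n + 1) := by positivity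
    linarith

lemma exists_freq_mul_windowMid (n : ℕ) : ∃ k : ℕ, freq n * windowMid σ n = k * (2 * Real.pi) := by
  induction n with
  | zero => exact ⟨0, by simp [windowMid]⟩
  | succ n ih =>
    obtain ⟨k, hk⟩ := ih
    have h0 := (freq_pos (n + 1)).ne'
    have h1 : freq (n + 1) * windowMid σ n = 65536 * k * (2 * Real.pi) := by
      rw [freq_succ]; linear_combination 65536 * hk
    rw [windowMid_succ]
    split_ifs
    · refine ⟨65536 * k + 1, ?_⟩
      rw [mul_add, h1, mul_div_cancel₀ _ h0]
      push_cast; ring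
    · exact ⟨65536 * k, by rw [add_zero, h1]; push_cast; ring⟩

lemma expTerm_eq (n : ℕ) (z : ℂ) : expTerm n z =
    size n z.re * cexp ((freq n * (z.im - windowMid σ n) : ℝ) * I) := by
  obtain ⟨k, hk⟩ := exists_freq_mul_windowMid σ n
  have hk' : (freq n : ℂ) * windowMid σ n = k * (2 * Real.pi) := by exact_mod_cast hk
  have : (freq n : ℂ) * z = (freq n * z.re : ℝ) +
      (((freq n * (z.im - windowMid σ n) : ℝ) * I) + k * (2 * Real.pi * I)) := by
    conv_lhs => rw [← re_add_im z]
    push_cast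
    linear_combination I * hk'
  rw [expTerm, this, Complex.exp_add, exp_periodic.nat_mul, size]
  push_cast
  ring

lemma expTerm_re (n : ℕ) (z : ℂ) : (expTerm n z).re =
    size n z.re * Real.cos (freq n * (z.im - windowMid σ n)) := by
  rw [expTerm_eq σ, re_ofReal_mul, exp_ofReal_mul_I_re]

lemma expTerm_im (n : ℕ) (z : ℂ) : (expTerm n z).im =
    size n z.re * Real.sin (freq n * (z.im - windowMid σ n)) := by
  rw [expTerm_eq σ, im_ofReal_mul, exp_ofReal_mul_I_im]

lemma mem_window_iff {n : ℕ} {y : ℝ} :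
    y ∈ Icc (windowLo σ n) (windowHi σ n) ↔ |freq n * (y - windowMid σ n)| ≤ 1 / 4 := by
  have h := freq_pos n
  have h4 : freq n * (1 / (4 * freq n)) = 1 / 4 := by field_simp
  rw [abs_mul, abs_of_pos h, ← h4, mul_le_mul_iff_right₀ h, abs_le, windowLo, windowHi, mem_Icc]
  constructor <;> rintro ⟨h1, h2⟩ <;> constructor <;> linarith

lemma windowLo_lt_windowHi (n : ℕ) : windowLo σ n < windowHi σ n := by
  have := freq_pos n
  have : 0 < 1 / (4 * freq n) := by positivity
  simp only [windowLo, windowHi]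
  linarith

lemma one_div_freq_succ (n : ℕ) : 1 / (4 * freq n) = 65536 * (1 / (4 * freq (n + 1))) := by
  have := freq_pos n
  rw [freq_succ]
  field_simp

lemma windowLo_monotone : Monotone (windowLo σ) := monotone_nat_of_le_succ fun n => by
  have := freq_pos (n + 1)
  have : 0 < 1 / (4 * freq (n + 1)) := by positivity
  simp only [windowLo]
  linarith [windowMid_le_succ σ n, one_div_freq_succ n]

lemma windowHi_antitone : Antitone (windowHi σ) := antitone_nat_of_succ_le fun n => by
  have := freq_pos (n + 1)
  have h1 : 0 < 1 / (4 * freq (n + 1)) := by positivity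
  have h2 : 2 * Real.pi / freq (n + 1) = 8 * Real.pi * (1 / (4 * freq (n + 1))) := by
    field_simp; norm_num
  have h3 : 8 * Real.pi * (1 / (4 * freq (n + 1))) ≤ 32 * (1 / (4 * freq (n + 1))) :=
    mul_le_mul_of_nonneg_right (by linarith [Real.pi_le_four]) h1.le
  simp only [windowHi]
  linarith [windowMid_succ_le σ n, one_div_freq_succ n]

/-- The sum of the terms of index less than `n` is small compared with the `n`-th term, apart from
a contribution with positive real part. -/
lemma partialSum_bounds {n : ℕ} {z : ℂ} (hn : n = 0 ∨ (n : ℝ) ≤ z.re)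
    (hy : |freq n * (z.im - windowMid σ n)| ≤ 1 / 4) :
    -(size n z.re / 64) ≤ (∑ m ∈ Finset.range n, expTerm m z).re ∧
      |(∑ m ∈ Finset.range n, expTerm m z).im| ≤ size n z.re * (1 / 50) := by
  rcases n with _ | n
  · simp [(size_pos 0 z.re).le]
    linarith [size_pos 0 z.re]
  have hx : (n : ℝ) + 1 ≤ z.re := by simpa using hn
  have hlow : ‖∑ m ∈ Finset.range n, expTerm m z‖ ≤ size n z.re / 1024 :=
    (norm_sum_le _ _).trans (by simpa only [norm_expTerm] using sum_size_le hx)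
  have hs := size_le_succ hx
  have hp := size_pos n z.re
  have hre := abs_le.1 ((abs_re_le_norm _).trans hlow)
  have him := abs_le.1 ((abs_im_le_norm _).trans hlow)
  have hφ : |freq n * (z.im - windowMid σ n)| ≤ 1 / 4096 := by
    have h1 := windowMid_le_succ σ n
    have h2 := windowMid_succ_le σ n
    have h3 : freq (n + 1) * (2 * Real.pi / freq (n + 1)) = 2 * Real.pi :=
      mul_div_cancel₀ _ (freq_pos (n + 1)).ne'
    have h4 := Real.pi_le_four
    have hf := freq_pos (n + 1)
    have h5 : freq n * (z.im - windowMid σ n) =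
        (freq (n + 1) * (z.im - windowMid σ (n + 1)) +
          freq (n + 1) * (windowMid σ (n + 1) - windowMid σ n)) / 65536 := by
      rw [freq_succ]; ring
    have h6 : 0 ≤ freq (n + 1) * (windowMid σ (n + 1) - windowMid σ n) :=
      mul_nonneg hf.le (by linarith)
    have h7 : freq (n + 1) * (windowMid σ (n + 1) - windowMid σ n) ≤ 2 * Real.pi := by
      rw [← h3]; exact mul_le_mul_of_nonneg_left (by linarith) hf.le
    have h8 := abs_le.1 hy
    rw [h5, abs_le]
    constructor <;> linarith
  have hcos : 0 ≤ Real.cos (freq n * (z.im - windowMid σ n)) :=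
    Real.cos_nonneg_of_mem_Icc (by
      have := abs_le.1 hφ
      constructor <;> linarith [Real.pi_gt_three])
  have hsin : |(expTerm n z).im| ≤ size n z.re / 4096 := by
    rw [expTerm_im σ, abs_mul, abs_of_pos hp]
    have := Real.abs_sin_le_abs (x := freq n * (z.im - windowMid σ n))
    nlinarith
  have hre' : 0 ≤ (expTerm n z).re := by
    rw [expTerm_re σ]; exact mul_nonneg hp.le hcos
  have hsin' := abs_le.1 hsin
  rw [Finset.sum_range_succ, add_re, add_im]
  refine ⟨by linarith, abs_le.2 ⟨?_, ?_⟩⟩ <;> linarith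

/-- In the `n`-th window the `n`-th term dominates the series. -/
lemma expSeries_bounds {n : ℕ} {z : ℂ} (hn : n = 0 ∨ (n : ℝ) ≤ z.re) (hx : z.re ≤ n + 1)
    (hy : |freq n * (z.im - windowMid σ n)| ≤ 1 / 4) :
    size n z.re * (7 / 8) ≤ (expSeries z).re ∧
      |(expSeries z).im - size n z.re * Real.sin (freq n * (z.im - windowMid σ n))| ≤
        size n z.re * (9 / 100) := by
  have hp := size_pos n z.re
  obtain ⟨h1, h2⟩ := partialSum_bounds σ hn hy
  have h3 := norm_tail_le hx
  have h4 := abs_le.1 ((abs_re_le_norm _).trans h3)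
  have h5 := abs_le.1 ((abs_im_le_norm _).trans h3)
  have h6 := abs_le.1 h2
  have hcos : 31 / 32 ≤ Real.cos (freq n * (z.im - windowMid σ n)) := by
    have h7 := Real.one_sub_sq_div_two_le_cos (x := freq n * (z.im - windowMid σ n))
    have h8 := sq_le_sq' (abs_le.1 hy).1 (abs_le.1 hy).2
    linarith
  have h9 := mul_le_mul_of_nonneg_left hcos hp.le
  rw [expSeries_eq n, add_re, add_re, add_im, add_im, expTerm_re σ, expTerm_im σ]
  refine ⟨by linarith, abs_le.2 ⟨?_, ?_⟩⟩ <;> linarith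

lemma exists_index {z : ℂ} (hz : z ∈ tube (windowLo σ) (windowHi σ)) :
    ∃ n : ℕ, (n = 0 ∨ (n : ℝ) ≤ z.re) ∧ z.re ≤ n + 1 ∧
      |freq n * (z.im - windowMid σ n)| ≤ 1 / 4 := by
  simp only [← mem_window_iff]
  rcases le_or_gt z.re 1 with h | h
  · exact ⟨0, Or.inl rfl, by simpa using h, hz.1⟩
  · have h1 : ⌈z.re⌉₊ ≠ 0 := (Nat.ceil_pos.2 (by linarith)).ne'
    obtain ⟨n, hn⟩ := Nat.exists_eq_succ_of_ne_zero h1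
    have h2 : (n : ℝ) < z.re := Nat.lt_ceil.1 (by omega)
    have h3 : z.re ≤ n + 1 := by
      have := Nat.le_ceil z.re
      rw [hn] at this
      simpa using this
    exact ⟨n, Or.inr h2.le, h3, hz.2 n h2⟩

lemma quarter_sin : 1 / 5 ≤ Real.sin (1 / 4) := by
  have := Real.sin_gt_sub_cube (x := 1 / 4) (by norm_num)
  norm_num at this ⊢
  linarith

lemma isFunnel_expSeries : IsFunnel expSeries (windowLo σ) (windowHi σ) (1 / 64) where
  diff := differentiable_expSeries
  lo_mono := windowLo_monotone σ
  hi_anti := windowHi_antitone σ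
  lo_lt_hi := windowLo_lt_windowHi σ
  zero_mem := by rw [mem_window_iff]; simp [windowMid]
  c_pos := by norm_num
  le_re z hz := by
    obtain ⟨n, hn, hx, hy⟩ := exists_index σ hz
    linarith [exp_le_size hn, (expSeries_bounds σ hn hx hy).1, Real.exp_pos z.re]
  im_le z hz := by
    obtain ⟨n, hn, hx, hy⟩ := exists_index σ hz
    obtain ⟨h1, h2⟩ := expSeries_bounds σ hn hx hy
    have hp := size_pos n z.re
    have h3 := abs_le.1 (Real.abs_sin_le_abs.trans hy)
    have h4 := mul_le_mul_of_nonneg_left h3.1 hp.le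
    have h5 := mul_le_mul_of_nonneg_left h3.2 hp.le
    have h6 := abs_le.1 h2
    exact abs_le.2 ⟨by linarith, by linarith⟩
  norm_le z _ hx := by
    have h1 := norm_tail_le (n := 0) (z := z) (by simp; linarith)
    have h2 : size 0 z.re ≤ 1 := by rw [size_zero]; exact Real.exp_le_one_iff.2 hx
    have h3 := norm_add_le (expTerm 0 z) (∑' k, expTerm (k + (0 + 1)) z)
    rw [norm_expTerm] at h3
    rw [expSeries_eq 0, Finset.sum_range_zero, zero_add]
    linarith
  hi_side n x hn hx := by
    have hf := freq_pos n
    have hφ : freq n * (windowHi σ n - windowMid σ n) = 1 / 4 := by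
      simp only [windowHi]; field_simp; ring
    have h := (expSeries_bounds σ (n := n) (z := x + windowHi σ n * I) (by simpa using hn)
      (by simpa using hx) (by simp [hφ])).2
    have hp := size_pos n x
    simp only [add_re, ofReal_re, mul_re, I_re, mul_zero, ofReal_im, I_im, mul_one, sub_self,
      add_zero, add_im, mul_im, zero_add, hφ] at h
    nlinarith [(abs_le.1 h).1, quarter_sin]
  lo_side n x hn hx := by
    have hf := freq_pos n
    have hφ : freq n * (windowLo σ n - windowMid σ n) = -(1 / 4) := by
      simp only [windowLo]; field_simp; ring
    have h := (expSeries_bounds σ (n := n) (z := x + windowLo σ n * I) (by simpa using hn)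
      (by simpa using hx) (by simp [hφ])).2
    have hp := size_pos n x
    simp only [add_re, ofReal_re, mul_re, I_re, mul_zero, ofReal_im, I_im, mul_one, sub_self,
      add_zero, add_im, mul_im, zero_add, hφ, Real.sin_neg] at h
    nlinarith [(abs_le.1 h).2, quarter_sin]

end Windows

lemma transcendentalEntire_expSeries : TranscendentalEntire expSeries := by
  refine ⟨differentiable_expSeries, fun ⟨p, hp⟩ => ?_⟩
  have hroots : ∀ k : ℕ, (k * (2 * Real.pi * I) : ℂ) ∈
      {z | (p - Polynomial.C (p.eval 0)).IsRoot z} := fun k => by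
    have := expSeries_add_two_pi 0 k
    rw [zero_add] at this
    simp [← hp, this]
  have hinj : Function.Injective fun k : ℕ => (k * (2 * Real.pi * I) : ℂ) := fun k l h => by
    exact_mod_cast mul_right_cancel₀ two_pi_I_ne_zero h
  have hconst : p = Polynomial.C (p.eval 0) := sub_eq_zero.1
    (Polynomial.eq_zero_of_infinite_isRoot _ ((infinite_range_of_injective hinj).mono
      (range_subset_iff.2 hroots)))
  have heq : expSeries (200 : ℝ) = expSeries 0 := by
    rw [hp, hp, hconst, Polynomial.eval_C, Polynomial.eval_C]
  set σ : ℕ → Bool := fun _ => false with hσ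
  have hmem : ∀ x : ℝ, (x : ℂ) ∈ tube (windowLo σ) (windowHi σ) := fun x => by
    have : ∀ n, (0 : ℝ) ∈ Icc (windowLo σ n) (windowHi σ n) := fun n => by
      rw [mem_window_iff]; simp [windowMid, hσ]
    exact ⟨by simpa using this 0, fun m _ => by simpa using this m⟩
  have H := isFunnel_expSeries σ
  have h1 := H.le_re _ (hmem 200)
  have h2 := H.norm_le 0 (by simpa using hmem 0) (by simp)
  have h3 := (re_le_norm _).trans h2
  have h4 := Real.add_one_le_exp (200 : ℝ)
  rw [heq, ofReal_re] at h1
  linarith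

lemma windowMid_congr {σ σ' : ℕ → Bool} {n : ℕ} (h : ∀ j < n, σ j = σ' j) :
    windowMid σ n = windowMid σ' n :=
  Finset.sum_congr rfl fun j hj => by rw [h j (Finset.mem_range.1 hj)]

/-- If two addresses first differ at the index `n`, then their windows of index `n + 1` are
disjoint. -/
lemma disjoint_windows {σ σ' : ℕ → Bool} {n : ℕ} (h : ∀ j < n, σ j = σ' j) (hn : σ n ≠ σ' n) :
    Disjoint (Icc (windowLo σ (n + 1)) (windowHi σ (n + 1)))
      (Icc (windowLo σ' (n + 1)) (windowHi σ' (n + 1))) := by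
  rw [Set.disjoint_left]
  intro y hy hy'
  rw [mem_window_iff, abs_le] at hy hy'
  have h3 : freq (n + 1) * (2 * Real.pi / freq (n + 1)) = 2 * Real.pi :=
    mul_div_cancel₀ _ (freq_pos (n + 1)).ne'
  rw [windowMid_succ, ← windowMid_congr h] at hy'
  rw [windowMid_succ] at hy
  have := Real.pi_gt_three
  cases h1 : σ n <;> cases h2 : σ' n <;> simp [h1, h2, mul_sub, mul_add, h3] at hn hy hy' <;>
    linarith

lemma tube_congr {σ σ' : ℕ → Bool} {n : ℕ} (h : ∀ j < n, σ j = σ' j) {z : ℂ}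
    (hre : z.re ≤ n + 1) (hz : z ∈ tube (windowLo σ) (windowHi σ)) :
    z ∈ tube (windowLo σ') (windowHi σ') := by
  have key : ∀ m ≤ n, windowLo σ m = windowLo σ' m ∧ windowHi σ m = windowHi σ' m := fun m hm => by
    simp only [windowLo, windowHi, windowMid_congr fun j hj => h j (hj.trans_le hm), and_self]
  refine ⟨by rw [← (key 0 n.zero_le).1, ← (key 0 n.zero_le).2]; exact hz.1, fun m hm => ?_⟩
  have hmn : m ≤ n := by
    have : (m : ℝ) < (n + 1 : ℕ) := by push_cast; linarith
    exact Nat.lt_succ_iff.1 (by exact_mod_cast this)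
  rw [← (key m hmn).1, ← (key m hmn).2]
  exact hz.2 m hm

/-- Trajectories in funnels with different addresses lie on different level sets of
`Im flowTime`. -/
lemma level_ne {σ σ' : ℕ → Bool} (hσ : σ ≠ σ') {z z' : ℝ → ℂ} {d d' : ℝ}
    (hz : ∀ x, z x ∈ tube (windowLo σ) (windowHi σ) ∧ (flowTime expSeries (z x)).im = d ∧
      (z x).re = x ∧ (z x).im ∈ Ioo (windowLo σ ⌊x⌋₊) (windowHi σ ⌊x⌋₊))
    (hz' : ∀ x, z' x ∈ tube (windowLo σ') (windowHi σ') ∧ (flowTime expSeries (z' x)).im = d' ∧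
      (z' x).re = x ∧ (z' x).im ∈ Ioo (windowLo σ' ⌊x⌋₊) (windowHi σ' ⌊x⌋₊)) : d ≠ d' := by
  rintro rfl
  have hex : ∃ n, σ n ≠ σ' n := Function.ne_iff.1 hσ
  classical
  set n := Nat.find hex
  have hn : σ n ≠ σ' n := Nat.find_spec hex
  have hlt : ∀ j < n, σ j = σ' j := fun j hj => not_not.1 (Nat.find_min hex hj)
  obtain ⟨h1, h2, h3, h4⟩ := hz ((n + 1 : ℕ) : ℝ)
  obtain ⟨h1', h2', h3', h4'⟩ := hz' ((n + 1 : ℕ) : ℝ)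
  rw [Nat.floor_natCast] at h4 h4'
  have h5 := tube_congr hlt (by rw [h3]; push_cast; exact le_rfl) h1
  rw [← re_add_im (z _), h3] at h2 h5
  rw [← re_add_im (z' _), h3'] at h2' h1'
  have := (isFunnel_expSeries σ').eq_of_flowTime_im_eq h5 h1' (h2.trans h2'.symm)
  rw [← this] at h4'
  exact Set.disjoint_left.1 (disjoint_windows hlt hn) (Ioo_subset_Icc_self h4)
    (Ioo_subset_Icc_self h4')

lemma exists_injective_real_address : ∃ s : ℝ → ℕ → Bool, Function.Injective s := by
  have : Cardinal.mk ℝ = Cardinal.mk (ℕ → Bool) := by simp [Cardinal.mk_real]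
  obtain ⟨e⟩ := Cardinal.eq.1 this
  exact ⟨e, e.injective⟩

/-- There exists a transcendental entire function `f` for which the holomorphic flow
`ż = f(z)` has uncountably many pairwise disjoint trajectories tending to infinity in finite
increasing time (a family indexed injectively by `ℝ`). -/
theorem exists_entire_uncountably_many_escaping_trajectories :
    ∃ f : ℂ → ℂ, TranscendentalEntire f ∧
      ∃ (Z : ℝ → ℝ → ℂ) (A B : ℝ → EReal),
        (∀ Y : ℝ, EscapesInFiniteTime f (A Y) (B Y) (Z Y)) ∧
        Pairwise fun Y Y' =>
          Disjoint (Traj (A Y) (B Y) (Z Y)) (Traj (A Y') (B Y') (Z Y')) := by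
  obtain ⟨s, hs⟩ := exists_injective_real_address
  choose d B Z hesc hlevel hpt using fun Y => (isFunnel_expSeries (s Y)).exists_escaping
  choose t htB ht using hpt
  refine ⟨expSeries, transcendentalEntire_expSeries, Z, fun _ => ⊥, fun Y => B Y, hesc,
    fun Y Y' hne => Set.disjoint_left.2 ?_⟩
  rintro _ ⟨t₁, h₁, rfl⟩ ⟨t₂, h₂, h⟩
  have hd := (hlevel Y t₁ (EReal.coe_lt_coe_iff.1 h₁.2)).2
  have hd' := (hlevel Y' t₂ (EReal.coe_lt_coe_iff.1 h₂.2)).2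
  have hpath : ∀ (Y x : ℝ), Z Y (t Y x) ∈ tube (windowLo (s Y)) (windowHi (s Y)) ∧
      (flowTime expSeries (Z Y (t Y x))).im = d Y ∧ (Z Y (t Y x)).re = x ∧
      (Z Y (t Y x)).im ∈ Ioo (windowLo (s Y) ⌊x⌋₊) (windowHi (s Y) ⌊x⌋₊) := fun Y x =>
    ⟨(hlevel Y _ (htB Y x)).1, (hlevel Y _ (htB Y x)).2, ht Y x⟩
  exact level_ne (hs.ne hne) (hpath Y) (hpath Y') (by rw [← hd, ← hd', h])
end
end
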